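/- Let X be a Hadamard space which is a visibility space. Then there is no isometric embedding of the Euclidean plane ℝ² (with its Euclidean metric) into the quadratic Wasserstein space W₂(X); in other words, W₂(X) has rank 1. -/

import Mathlib

open MeasureTheory Filter Set Topology
open scoped NNReal ENNReal

noncomputable section


/-! ## Geodesics and Hadamard spaces -/

/-- `γ` is a geodesic on the set of parameters `s`, of speed `v`, with respect to the
distance function `d`. -/
def IsGeodesicOnWith {A : Type*} (d : A → A → ℝ) (γ : ℝ → A) (s : Set ℝ) (v : ℝ) : Prop :=
  ∀ t ∈ s, ∀ t' ∈ s, d (γ t) (γ t') = v * |t - t'|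

/-- A metric space is geodesic if any two points are joined by a geodesic. -/
def IsGeodesicSpace (Y : Type*) [MetricSpace Y] : Prop :=
  ∀ x y : Y, ∃ γ : ℝ → Y, γ 0 = x ∧ γ 1 = y ∧
    IsGeodesicOnWith dist γ (Set.Icc (0:ℝ) 1) (dist x y)

/-- Every geodesic segment extends to a complete geodesic (defined on all of `ℝ`). -/
def GeodesicallyComplete (Y : Type*) [MetricSpace Y] : Prop :=
  ∀ (γ : ℝ → Y) (a b v : ℝ), a < b → IsGeodesicOnWith dist γ (Set.Icc a b) v →
    ∃ g : ℝ → Y, IsGeodesicOnWith dist g Set.univ v ∧ ∀ t ∈ Set.Icc a b, g t = γ t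

/-- A Hadamard space: complete, separable, locally compact, geodesic, globally CAT(0).
The CAT(0) comparison inequality is expressed through the explicit formula for the distance
from a vertex to a point of the opposite side in the Euclidean comparison triangle. -/
structure IsHadamard (X : Type*) [MetricSpace X] : Prop where
  complete : CompleteSpace X
  separable : TopologicalSpace.SeparableSpace X
  locallyCompact : LocallyCompactSpace X
  geodesic : IsGeodesicSpace X
  cat0 : ∀ (x y z : X) (γ : ℝ → X), γ 0 = y → γ 1 = z →
    IsGeodesicOnWith dist γ (Set.Icc (0:ℝ) 1) (dist y z) →
    ∀ t ∈ Set.Icc (0:ℝ) 1,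
      dist x (γ t) ^ 2 ≤ (1 - t) * dist x y ^ 2 + t * dist x z ^ 2 - t * (1 - t) * dist y z ^ 2

/-- A space is non-branching if two geodesics coinciding on a nonempty open set of parameters
coincide on their whole common interval of definition. -/
def NonBranching (X : Type*) [MetricSpace X] : Prop :=
  ∀ (γ β : ℝ → X) (I : Set ℝ) (v w : ℝ),
    IsGeodesicOnWith dist γ I v → IsGeodesicOnWith dist β I w →
    (∃ U : Set ℝ, U ⊆ I ∧ IsOpen U ∧ U.Nonempty ∧ ∀ t ∈ U, γ t = β t) →
    ∀ t ∈ I, γ t = β t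

/-! ## The Wasserstein space -/

/-- `π` is a coupling (transport plan) between `μ` and `ν`. -/
def IsCoupling {A B : Type*} [MeasurableSpace A] [MeasurableSpace B]
    (π : Measure (A × B)) (μ : Measure A) (ν : Measure B) : Prop :=
  π.map Prod.fst = μ ∧ π.map Prod.snd = ν

/-- The quadratic Wasserstein space over `Y`: Borel probability measures with finite second
moment. -/
abbrev W2Space (Y : Type*) [MetricSpace Y] [MeasurableSpace Y] : Type _ :=
  {μ : Measure Y // IsProbabilityMeasure μ ∧
    ∃ x₀ : Y, (∫⁻ x, ENNReal.ofReal (dist x₀ x) ^ 2 ∂μ) < ⊤}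

/-- The quadratic transport cost between two measures. -/
def W2cost {Y : Type*} [MetricSpace Y] [MeasurableSpace Y] (μ ν : Measure Y) : ℝ≥0∞ :=
  ⨅ (π : Measure (Y × Y)) (_ : IsCoupling π μ ν),
    ∫⁻ p, ENNReal.ofReal (dist p.1 p.2) ^ 2 ∂π

/-- The quadratic Wasserstein distance. -/
def Wdist {Y : Type*} [MetricSpace Y] [MeasurableSpace Y] (μ ν : W2Space Y) : ℝ :=
  Real.sqrt (W2cost μ.1 ν.1).toReal


/-! ## Rays, complete geodesics, the boundary at infinity and the cone over it -/

/-- Geodesic rays of `X` (arbitrary nonnegative speed), parametrized by `ℝ≥0`.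
The topology (of a subtype of a product) coincides on this set with the topology of
uniform convergence on compact sets. -/
abbrev RaySpace (X : Type*) [MetricSpace X] : Type _ :=
  {γ : ℝ≥0 → X // ∃ v : ℝ, 0 ≤ v ∧ ∀ s t : ℝ≥0, dist (γ s) (γ t) = v * dist s t}

/-- Unit speed geodesic rays of `X`. -/
abbrev UnitRay (X : Type*) [MetricSpace X] : Type _ :=
  {γ : ℝ≥0 → X // ∀ s t : ℝ≥0, dist (γ s) (γ t) = dist s t}

/-- Complete geodesics of `X` (arbitrary nonnegative speed). -/
abbrev GeoLine (X : Type*) [MetricSpace X] : Type _ :=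
  {γ : ℝ → X // ∃ v : ℝ, 0 ≤ v ∧ ∀ s t : ℝ, dist (γ s) (γ t) = v * |s - t|}

/-- Complete unit speed geodesics of `X`. -/
abbrev UnitLine (X : Type*) [MetricSpace X] : Type _ :=
  {γ : ℝ → X // ∀ s t : ℝ, dist (γ s) (γ t) = |s - t|}

/-- Evaluation of a ray at time `t`. -/
def rayEval {X : Type*} [MetricSpace X] (t : ℝ≥0) : RaySpace X → X := fun γ => γ.1 t

/-- Two curves (w.r.t. a distance function `d`) are asymptotic if they stay at bounded
distance. -/
def AsymptoticMaps {A : Type*} (d : A → A → ℝ) (γ β : ℝ≥0 → A) : Prop :=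
  ∃ C : ℝ, ∀ t, d (γ t) (β t) ≤ C

/-- The asymptote relation on unit-speed rays. -/
def unitRaySetoid (X : Type*) [MetricSpace X] : Setoid (UnitRay X) where
  r γ β := AsymptoticMaps dist γ.1 β.1
  iseqv := by
    refine ⟨fun γ => ⟨0, fun t => by simp⟩, ?_, ?_⟩
    · rintro γ β ⟨C, h⟩
      exact ⟨C, fun t => by rw [dist_comm]; exact h t⟩
    · rintro γ β δ ⟨C, h⟩ ⟨C', h'⟩
      exact ⟨C + C', fun t => (dist_triangle _ _ _).trans (add_le_add (h t) (h' t))⟩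

/-- The geodesic boundary of `X`: asymptote classes of unit-speed rays, with the quotient
topology of the topology of uniform convergence on compact sets (the cone topology). -/
abbrev Boundary (X : Type*) [MetricSpace X] := Quotient (unitRaySetoid X)

/-- Apex-like points, to be collapsed when forming the cone over `B`. -/
def coneIsApex {B : Type*} : B × ℝ≥0 ⊕ Unit → Prop
  | Sum.inl p => p.2 = 0
  | Sum.inr _ => True

/-- The relation collapsing all apex-like points. -/
def coneSetoid (B : Type*) : Setoid (B × ℝ≥0 ⊕ Unit) where
  r p q := p = q ∨ (coneIsApex p ∧ coneIsApex q)
  iseqv := by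
    refine ⟨fun p => Or.inl rfl, ?_, ?_⟩
    · rintro p q (rfl | h)
      · exact Or.inl rfl
      · exact Or.inr ⟨h.2, h.1⟩
    · rintro p q r (rfl | h) (rfl | h')
      · exact Or.inl rfl
      · exact Or.inr h'
      · exact Or.inr h
      · exact Or.inr ⟨h.1, h'.2⟩

/-- The cone over a space `B`: the quotient of `B × [0,∞)` collapsing the zero level to the
apex, with the quotient topology. -/
abbrev Cone (B : Type*) := Quotient (coneSetoid B)

/-- The point of the cone over `b` at height (speed) `s`. -/
def coneMk {B : Type*} (b : B) (s : ℝ≥0) : Cone B :=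
  Quotient.mk (coneSetoid B) (Sum.inl (b, s))

/-- The apex of the cone. -/
def conePt (B : Type*) : Cone B := Quotient.mk (coneSetoid B) (Sum.inr ())

private def coneSpeedAux {B : Type*} : B × ℝ≥0 ⊕ Unit → ℝ≥0
  | Sum.inl p => p.2
  | Sum.inr _ => 0

/-- The speed (radial) coordinate of a point of the cone. -/
def coneSpeed {B : Type*} : Cone B → ℝ≥0 :=
  Quotient.lift coneSpeedAux (by
    rintro p q (rfl | ⟨h1, h2⟩)
    · rfl
    · cases p <;> cases q <;> simp_all [coneIsApex, coneSpeedAux])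

/-- The speed of a geodesic ray. -/
def raySpeed {X : Type*} [MetricSpace X] (γ : RaySpace X) : ℝ≥0 :=
  nndist (γ.1 0) (γ.1 1)

lemma raySpeed_eq {X : Type*} [MetricSpace X] (γ : RaySpace X) {v : ℝ} (hv0 : 0 ≤ v)
    (hv : ∀ s t : ℝ≥0, dist (γ.1 s) (γ.1 t) = v * dist s t) : (raySpeed γ : ℝ) = v := by
  have h1 := hv 0 1
  have h2 : dist (0 : ℝ≥0) (1 : ℝ≥0) = 1 := by rw [NNReal.dist_eq]; norm_num
  rw [h2, mul_one] at h1
  rw [show (raySpeed γ : ℝ) = dist (γ.1 0) (γ.1 1) from (dist_nndist _ _).symm, h1]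

/-- The unit reparametrization of a nonconstant ray. -/
def rayUnit {X : Type*} [MetricSpace X] (γ : RaySpace X) (h : raySpeed γ ≠ 0) : UnitRay X := by
  refine ⟨fun t => γ.1 (t / raySpeed γ), ?_⟩
  obtain ⟨v, hv0, hv⟩ := γ.2
  have hveq : (raySpeed γ : ℝ) = v := raySpeed_eq γ hv0 hv
  intro s t
  have hr : (raySpeed γ : ℝ) ≠ 0 := by
    simpa using h
  show dist (γ.1 (s / raySpeed γ)) (γ.1 (t / raySpeed γ)) = dist s t
  rw [hv, NNReal.dist_eq, NNReal.dist_eq, NNReal.coe_div, NNReal.coe_div,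
    div_sub_div_same, abs_div, abs_of_nonneg (raySpeed γ).coe_nonneg, ← hveq]
  field_simp

/-- The point at infinity (in the cone over the boundary) defined by a geodesic ray:
its asymptote class together with its speed; constant rays are sent to the apex. -/
def rayEnd {X : Type*} [MetricSpace X] (γ : RaySpace X) : Cone (Boundary X) :=
  if h : raySpeed γ = 0 then conePt (Boundary X)
  else coneMk (Quotient.mk (unitRaySetoid X) (rayUnit γ h)) (raySpeed γ)

/-! ## Asymptotic distance -/

def dInfty {X : Type*} [MetricSpace X] (γ β : ℝ≥0 → X) : ℝ :=
  Filter.limsup (fun t : ℝ≥0 => dist (γ t) (β t) / (t : ℝ)) Filter.atTop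

/-- The asymptotic (angular) distance on the boundary, computed on representative rays
(it does not depend on the choice of representatives). -/
def boundaryDist {X : Type*} [MetricSpace X] (ξ ζ : Boundary X) : ℝ :=
  dInfty (ξ.out).1 (ζ.out).1

def coneDistAux {X : Type*} [MetricSpace X] :
    Boundary X × ℝ≥0 ⊕ Unit → Boundary X × ℝ≥0 ⊕ Unit → ℝ
  | Sum.inl p, Sum.inl q =>
      Real.sqrt (((p.2 : ℝ) - (q.2 : ℝ)) ^ 2 + (p.2 : ℝ) * (q.2 : ℝ) * boundaryDist p.1 q.1 ^ 2)
  | Sum.inl p, Sum.inr _ => p.2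
  | Sum.inr _, Sum.inl q => q.2
  | Sum.inr _, Sum.inr _ => 0

/-- The asymptotic distance on the cone over the boundary (the cone metric). -/
def coneDist {X : Type*} [MetricSpace X] : Cone (Boundary X) → Cone (Boundary X) → ℝ :=
  Quotient.lift₂ coneDistAux (by
    rintro a₁ a₂ b₁ b₂ h12 h34
    rcases h12 with rfl | ⟨h1, h2⟩ <;> rcases h34 with rfl | ⟨h3, h4⟩
    · rfl
    · rcases a₁ with p | u <;> rcases a₂ with q | v <;> rcases b₂ with q' | w <;>
        simp_all [coneIsApex, coneDistAux, Real.sqrt_sq, NNReal.coe_nonneg]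
    · rcases a₂ with q | u <;> rcases a₁ with p | v <;> rcases b₁ with p' | w <;>
        simp_all [coneIsApex, coneDistAux, Real.sqrt_sq, NNReal.coe_nonneg]
    · rcases a₁ with p | u <;> rcases a₂ with q | v <;> rcases b₁ with p' | w <;>
        rcases b₂ with q' | w' <;>
        simp_all [coneIsApex, coneDistAux, Real.sqrt_sq, NNReal.coe_nonneg])


-- Borel measurable structure on the boundary and the cone over it.
instance (X : Type*) [MetricSpace X] : MeasurableSpace (Boundary X) := borel _
instance (X : Type*) [MetricSpace X] : BorelSpace (Boundary X) := ⟨rfl⟩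
instance (X : Type*) [MetricSpace X] : MeasurableSpace (Cone (Boundary X)) := borel _
instance (X : Type*) [MetricSpace X] : BorelSpace (Cone (Boundary X)) := ⟨rfl⟩

/-- The Wasserstein metric `W_∞` on measures on the cone over the boundary, built from the
cost `d_∞²`. -/
def Winfty {X : Type*} [MetricSpace X] (m m' : Measure (Cone (Boundary X))) : ℝ :=
  Real.sqrt (⨅ (π : Measure (Cone (Boundary X) × Cone (Boundary X)))
    (_ : IsCoupling π m m'),
      ∫⁻ p, ENNReal.ofReal (coneDist p.1 p.2) ^ 2 ∂π).toReal


/-! ## Visibility -/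

/-- `X` is a visibility space: any two distinct boundary points are the two endpoints of a
complete geodesic. -/
def IsVisibility (X : Type*) [MetricSpace X] : Prop :=
  ∀ α ω : UnitRay X, ¬ AsymptoticMaps dist α.1 ω.1 →
    ∃ g : ℝ → X, (∀ s t : ℝ, dist (g s) (g t) = |s - t|) ∧
      AsymptoticMaps dist (fun t : ℝ≥0 => g (-(t : ℝ))) α.1 ∧
      AsymptoticMaps dist (fun t : ℝ≥0 => g (t : ℝ)) ω.1

/-! ## Curves, length, rectifiability -/

/-- The length of a curve with respect to a distance function `d`, as a supremum over
finite monotone sequences of parameters in `[a,b]`. -/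
def curveLengthWith {A : Type*} (d : A → A → ℝ) (c : ℝ → A) (a b : ℝ) : ℝ≥0∞ :=
  ⨆ (n : ℕ) (t : Fin (n + 1) → ℝ) (_ : Monotone t) (_ : ∀ i, t i ∈ Set.Icc a b),
    ∑ i : Fin n, ENNReal.ofReal (d (c (t i.castSucc)) (c (t i.succ)))

/-- Continuity of a curve with respect to a distance function `d`, on a set of parameters. -/
def ContinuousWithRespect {A : Type*} (d : A → A → ℝ) (c : ℝ → A) (s : Set ℝ) : Prop :=
  ∀ t ∈ s, ∀ ε : ℝ, 0 < ε → ∃ δ : ℝ, 0 < δ ∧ ∀ u ∈ s, |u - t| < δ → d (c u) (c t) < ε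

/-- `W_∞` between measures on the boundary, viewed as the level `{speed = 1}` of the cone,
with cost `d_∞²`. -/
def WinftyLevel1 {X : Type*} [MetricSpace X] (m m' : Measure (Boundary X)) : ℝ :=
  Real.sqrt (⨅ (π : Measure (Boundary X × Boundary X)) (_ : IsCoupling π m m'),
    ∫⁻ p, ENNReal.ofReal (coneDist (coneMk p.1 1) (coneMk p.2 1)) ^ 2 ∂π).toReal

/-! ## Support of a measure -/

/-- The (topological) support of a measure. -/
def msupport {A : Type*} [TopologicalSpace A] [MeasurableSpace A] (μ : Measure A) : Set A :=
  {x | ∀ U : Set A, x ∈ U → IsOpen U → 0 < μ U}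

/-! ## Cyclical monotonicity and antagonism -/

/-- A set `Γ` is `c`-cyclically monotone if no cyclic permutation of the target points of a
finite family of pairs of `Γ` decreases the total cost. -/
def CyclicallyMonotone {A : Type*} (c : A → A → ℝ) (Γ : Set (A × A)) : Prop :=
  ∀ (m : ℕ) (p : Fin (m + 1) → A × A), (∀ i, p i ∈ Γ) →
    (∑ i, c (p i).1 (p i).2) ≤ ∑ i, c (p i).1 (p (i + 1)).2

/-- Two curves are antagonist if they pass through two distinct points in opposite orders. -/
def Antagonist {X : Type*} (γ β : ℝ → X) : Prop :=
  ∃ x y : X, x ≠ y ∧ (∃ s t : ℝ, s < t ∧ γ s = x ∧ γ t = y) ∧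
    (∃ s t : ℝ, s < t ∧ β s = y ∧ β t = x)

/-! ## Negative curvature, trees -/

/-- Three points lying on a common geodesic. -/
def Aligned {X : Type*} [MetricSpace X] (x y z : X) : Prop :=
  dist x y + dist y z = dist x z ∨ dist y x + dist x z = dist y z ∨
    dist x z + dist z y = dist x y

/-- `X` is negatively curved: it is not a line, and the CAT(0) comparison inequality is
strict except for aligned triangles. -/
def IsNegativelyCurved (X : Type*) [MetricSpace X] : Prop :=
  (¬ ∃ f : ℝ → X, Function.Surjective f ∧ ∀ s t : ℝ, dist (f s) (f t) = |s - t|) ∧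
  ∀ (x y z : X) (γ : ℝ → X), γ 0 = y → γ 1 = z →
    IsGeodesicOnWith dist γ (Set.Icc (0:ℝ) 1) (dist y z) → ¬ Aligned x y z →
    ∀ t ∈ Set.Ioo (0:ℝ) 1,
      dist x (γ t) ^ 2 < (1 - t) * dist x y ^ 2 + t * dist x z ^ 2 - t * (1 - t) * dist y z ^ 2

/-- A metric tree (real tree): a geodesic space satisfying the four-point 0-hyperbolicity
condition. -/
def IsRealTree (X : Type*) [MetricSpace X] : Prop :=
  IsGeodesicSpace X ∧ ∀ x y z w : X,
    dist x y + dist z w ≤ max (dist x z + dist y w) (dist x w + dist y z)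

/-! ## Ends of complete geodesics -/

/-- The forward ray of a complete geodesic. -/
def lineForward {X : Type*} [MetricSpace X] (γ : GeoLine X) : RaySpace X :=
  ⟨fun t : ℝ≥0 => γ.1 (t : ℝ), by
    obtain ⟨v, hv0, hv⟩ := γ.2
    exact ⟨v, hv0, fun s t => by rw [hv, NNReal.dist_eq]⟩⟩

/-- The backward ray of a complete geodesic. -/
def lineBackward {X : Type*} [MetricSpace X] (γ : GeoLine X) : RaySpace X :=
  ⟨fun t : ℝ≥0 => γ.1 (-(t : ℝ)), by
    obtain ⟨v, hv0, hv⟩ := γ.2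
    refine ⟨v, hv0, fun s t => ?_⟩
    rw [hv, NNReal.dist_eq]
    congr 1
    rw [abs_sub_comm]
    congr 1
    ring⟩

/-- The end at `+∞` of a complete geodesic, in the cone over the boundary. -/
def lineEndPlus {X : Type*} [MetricSpace X] (γ : GeoLine X) : Cone (Boundary X) :=
  rayEnd (lineForward γ)

/-- The end at `-∞` of a complete geodesic, in the cone over the boundary. -/
def lineEndMinus {X : Type*} [MetricSpace X] (γ : GeoLine X) : Cone (Boundary X) :=
  rayEnd (lineBackward γ)

/-- `g` is a unit complete geodesic with ends `ξ` (at `-∞`) and `ζ` (at `+∞`). -/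
def LineConnects {X : Type*} [MetricSpace X] (g : ℝ → X) (ξ ζ : Boundary X) : Prop :=
  (∀ s t : ℝ, dist (g s) (g t) = |s - t|) ∧
  (∃ γ : UnitRay X, Quotient.mk (unitRaySetoid X) γ = ξ ∧
    AsymptoticMaps dist (fun u : ℝ≥0 => g (-(u : ℝ))) γ.1) ∧
  (∃ γ : UnitRay X, Quotient.mk (unitRaySetoid X) γ = ζ ∧
    AsymptoticMaps dist (fun u : ℝ≥0 => g (u : ℝ)) γ.1)

/-- Two boundary points are antipodal if they are joined by a complete geodesic. -/
def Antipodal {X : Type*} [MetricSpace X] (ξ ζ : Boundary X) : Prop :=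
  ∃ g : ℝ → X, LineConnects g ξ ζ

/-- Two measures on the boundary are antipodal if they are concentrated on antipodal sets. -/
def AntipodalMeasures {X : Type*} [MetricSpace X] (νm νp : Measure (Boundary X)) : Prop :=
  ∃ A B : Set (Boundary X), MeasurableSet A ∧ MeasurableSet B ∧ νm A = 1 ∧ νp B = 1 ∧
    ∀ ξ ∈ A, ∀ ζ ∈ B, Antipodal ξ ζ

/-- Two measures on the boundary are uniformly antipodal if their supports are antipodal. -/
def UniformlyAntipodal {X : Type*} [MetricSpace X] (νm νp : Measure (Boundary X)) : Prop :=
  ∀ ξ ∈ msupport νm, ∀ ζ ∈ msupport νp, Antipodal ξ ζ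

/-- The distance from the base point `x₀` to the geodesic line joining two boundary points
(for trees, the Gromov product). -/
def D0 {X : Type*} [MetricSpace X] (x₀ : X) (ξ ζ : Boundary X) : ℝ :=
  sInf {r : ℝ | ∃ g : ℝ → X, LineConnects g ξ ζ ∧ ∃ t : ℝ, r = dist x₀ (g t)}

/-- The unit geodesic from `ξ` to `ζ`, parametrized so that its time-`0` point is closest to
the base point `x₀`. -/
def lineFrom {X : Type*} [MetricSpace X] (x₀ : X) (ξ ζ : Boundary X) : ℝ → X :=
  haveI : Nonempty X := ⟨x₀⟩
  Classical.epsilon fun g : ℝ → X =>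
    LineConnects g ξ ζ ∧ dist x₀ (g 0) = D0 x₀ ξ ζ

/-! ## Flows on trees -/

/-- The set of boundary points whose rays eventually lie in `C`. -/
def compBdry {X : Type*} [MetricSpace X] (C : Set X) : Set (Boundary X) :=
  {ξ | ∀ γ : UnitRay X, Quotient.mk (unitRaySetoid X) γ = ξ →
    ∃ T : ℝ≥0, ∀ t : ℝ≥0, T ≤ t → γ.1 t ∈ C}

/-- The connected components of the complement of a point. -/
def treeComps {X : Type*} [TopologicalSpace X] (x : X) : Set (Set X) :=
  {C | ∃ y : X, y ≠ x ∧ C = connectedComponentIn {x}ᶜ y}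

/-- A vertex (branch point) of a tree: the complement has at least three components. -/
def IsTreeVertex {X : Type*} [TopologicalSpace X] (x : X) : Prop :=
  ∃ C₁ C₂ C₃ : Set X, C₁ ∈ treeComps x ∧ C₂ ∈ treeComps x ∧ C₃ ∈ treeComps x ∧
    C₁ ≠ C₂ ∧ C₂ ≠ C₃ ∧ C₁ ≠ C₃

/-- The value of the signed measure `ν₊ - ν₋` on a set of boundary points. -/
def sflow {X : Type*} [MetricSpace X] (νm νp : Measure (Boundary X))
    (S : Set (Boundary X)) : ℝ :=
  (νp S).toReal - (νm S).toReal

/-- The boundary directions at `x` carrying positive flow. -/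
def posBdrySet {X : Type*} [MetricSpace X] (νm νp : Measure (Boundary X)) (x : X) :
    Set (Boundary X) :=
  ⋃ (C : Set X) (_ : C ∈ treeComps x) (_ : 0 < sflow νm νp (compBdry C)), compBdry C

/-- The boundary directions at `x` carrying negative flow. -/
def negBdrySet {X : Type*} [MetricSpace X] (νm νp : Measure (Boundary X)) (x : X) :
    Set (Boundary X) :=
  ⋃ (C : Set X) (_ : C ∈ treeComps x) (_ : sflow νm νp (compBdry C) < 0), compBdry C

/-- The flow through the point `x`. -/
def flowAt {X : Type*} [MetricSpace X] (νm νp : Measure (Boundary X)) (x : X) : ℝ :=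
  sflow νm νp (posBdrySet νm νp x)

open Classical in
/-- The specific flow through `x`: the flow through `x`, not counting the edge pointing
towards the base point `x₀` when the latter is positive (resp. negative). -/
def specificFlow {X : Type*} [MetricSpace X] (νm νp : Measure (Boundary X))
    (x₀ x : X) : ℝ :=
  if x = x₀ then flowAt νm νp x
  else if 0 < sflow νm νp (compBdry (connectedComponentIn {x}ᶜ x₀)) then
    sflow νm νp (posBdrySet νm νp x \ compBdry (connectedComponentIn {x}ᶜ x₀))
  else if sflow νm νp (compBdry (connectedComponentIn {x}ᶜ x₀)) < 0 then
    - sflow νm νp (negBdrySet νm νp x \ compBdry (connectedComponentIn {x}ᶜ x₀))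
  else flowAt νm νp x

/-- The pair `(ν₋, ν₊)` is realized as the pair of ends of a complete unit-speed geodesic of
the Wasserstein space, through a displacement interpolation `m`. -/
def RealizableEnds {X : Type*} [MetricSpace X] [MeasurableSpace X]
    (νm νp : Measure (Boundary X)) : Prop :=
  ∃ (μt : ℝ → W2Space X) (m : Measure (GeoLine X)), IsProbabilityMeasure m ∧
    (∀ s t : ℝ, Wdist (μt s) (μt t) = |s - t|) ∧
    (∀ t : ℝ, m.map (fun γ : GeoLine X => γ.1 t) = (μt t).1) ∧
    m.map lineEndMinus = νm.map (fun ξ : Boundary X => coneMk ξ 1) ∧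
    m.map lineEndPlus = νp.map (fun ξ : Boundary X => coneMk ξ 1)

/-- The cost `∫ D₀² dπ` of a transport plan (the optimal transport problem for the cost
`-D₀²` is finite iff the supremum of this quantity over all couplings is finite, and its
minimizers are the maximizers of this quantity). -/
def D0cost {X : Type*} [MetricSpace X] (x₀ : X)
    (π : Measure (Boundary X × Boundary X)) : ℝ≥0∞ :=
  ∫⁻ p, ENNReal.ofReal (D0 x₀ p.1 p.2) ^ 2 ∂π

/-- The supremum of `∫ D₀² dπ` over couplings of `(ν₋, ν₊)`. -/
def D0supCost {X : Type*} [MetricSpace X] (x₀ : X) (νm νp : Measure (Boundary X)) : ℝ≥0∞ :=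
  ⨆ (π : Measure (Boundary X × Boundary X)) (_ : IsCoupling π νm νp), D0cost x₀ π

/-! ## The geodesic boundary of the Wasserstein space -/

/-- The metric topology of the Wasserstein distance. -/
instance (Y : Type*) [MetricSpace Y] [MeasurableSpace Y] : TopologicalSpace (W2Space Y) :=
  TopologicalSpace.generateFrom
    {S | ∃ (μ : W2Space Y) (ε : ℝ), S = {ν : W2Space Y | Wdist μ ν < ε}}

/-- Unit-speed geodesic rays of the Wasserstein space. -/
abbrev W2UnitRay (X : Type*) [MetricSpace X] [MeasurableSpace X] : Type _ :=
  {f : ℝ≥0 → W2Space X // ∀ s t : ℝ≥0, Wdist (f s) (f t) = dist s t}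

/-- Probability measures on the cone over the boundary with `∫ v² dν = 1`, with the weak
topology. -/
abbrev P1Cone (X : Type*) [MetricSpace X] : Type _ :=
  {ν : ProbabilityMeasure (Cone (Boundary X)) //
    ∫⁻ c, (coneSpeed c : ℝ≥0∞) ^ 2 ∂(ν : Measure (Cone (Boundary X))) = 1}

/-- Probability measures (as plain measures) on the cone over the boundary with
`∫ v² dν = 1`. -/
abbrev P1ConeM (X : Type*) [MetricSpace X] : Type _ :=
  {ν : Measure (Cone (Boundary X)) // IsProbabilityMeasure ν ∧
    ∫⁻ c, (coneSpeed c : ℝ≥0∞) ^ 2 ∂ν = 1}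


/-! ## Locally Riemannian points -/

/-- The Riemannian length of a path `γ : [0,1] → ℝⁿ` for the metric tensor `g`. -/
def riemannianPathLength {n : ℕ}
    (g : EuclideanSpace ℝ (Fin n) → EuclideanSpace ℝ (Fin n) →L[ℝ] EuclideanSpace ℝ (Fin n))
    (γ : ℝ → EuclideanSpace ℝ (Fin n)) : ℝ :=
  ∫ t in (0:ℝ)..1, Real.sqrt (@inner ℝ _ _ (g (γ t) (deriv γ t)) (deriv γ t))

/-- The Riemannian distance in `U ⊆ ℝⁿ` for the metric tensor `g`: the infimum of
Riemannian lengths of `C¹` paths in `U` joining the two points. -/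
def riemannianDist {n : ℕ} (U : Set (EuclideanSpace ℝ (Fin n)))
    (g : EuclideanSpace ℝ (Fin n) → EuclideanSpace ℝ (Fin n) →L[ℝ] EuclideanSpace ℝ (Fin n))
    (p q : EuclideanSpace ℝ (Fin n)) : ℝ :=
  sInf {L : ℝ | ∃ γ : ℝ → EuclideanSpace ℝ (Fin n), ContDiffOn ℝ 1 γ (Set.Icc (0:ℝ) 1) ∧
    (∀ t ∈ Set.Icc (0:ℝ) 1, γ t ∈ U) ∧ γ 0 = p ∧ γ 1 = q ∧ L = riemannianPathLength g γ}

/-- `x` admits a neighborhood isometric to an open subset of a Riemannian manifold of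
dimension at least 2 (expressed in a chart: an open subset of `ℝⁿ`, `n ≥ 2`, equipped with
the distance induced by a smooth positive-definite symmetric metric tensor). -/
def IsLocallyRiemannian (X : Type*) [MetricSpace X] (x : X) : Prop :=
  ∃ n : ℕ, 2 ≤ n ∧
  ∃ (U : Set (EuclideanSpace ℝ (Fin n)))
    (g : EuclideanSpace ℝ (Fin n) → EuclideanSpace ℝ (Fin n) →L[ℝ] EuclideanSpace ℝ (Fin n))
    (V : Set X) (φ : X → EuclideanSpace ℝ (Fin n)),
    IsOpen U ∧ ContDiffOn ℝ (⊤ : ℕ∞) g U ∧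
    (∀ p ∈ U, ∀ v w : EuclideanSpace ℝ (Fin n),
      @inner ℝ _ _ (g p v) w = @inner ℝ _ _ v (g p w)) ∧
    (∀ p ∈ U, ∀ v : EuclideanSpace ℝ (Fin n), v ≠ 0 → 0 < @inner ℝ _ _ (g p v) v) ∧
    V ∈ nhds x ∧ Set.BijOn φ V U ∧
    ∀ a ∈ V, ∀ b ∈ V, dist a b = riemannianDist U g (φ a) (φ b)

/-! ## The combinatorial perpendicular Radon transform on a tree -/

/-- `y` and `z` lie in the same connected component of the graph `G` minus the vertex `x`. -/
def sameComp {V : Type*} (G : SimpleGraph V) (x y z : V) : Prop :=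
  ∃ (hy : y ≠ x) (hz : z ≠ x), (G.induce {w : V | w ≠ x}).Reachable ⟨y, hy⟩ ⟨z, hz⟩

/-- The perpendicular `⊥ˣ(ef)` of a flag: the union of `{x}` and of the components of
`G - x` containing none of the vertices of `p` (for a flag, `p = {e, f}` is a pair of
neighbors of `x`). -/
def perpSet {V : Type*} (G : SimpleGraph V) (x : V) (p : Finset V) : Set V :=
  {x} ∪ {y | ∀ e ∈ p, ¬ sameComp G x y e}

/-- The combinatorial perpendicular Radon transform of a summable function `h` on the
vertices, evaluated on a flag `(x, p)`. -/
def perpRadon {V : Type*} (G : SimpleGraph V) (h : V → ℝ) (x : V) (p : Finset V) : ℝ :=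
  ∑' y : perpSet G x p, h y

/-! ## Convexity and properness of Hadamard spaces -/

section HadamardGeometry

variable {X : Type*} [MetricSpace X]

/-- In a Hadamard space, two geodesics issued from the same point diverge at least linearly. -/
lemma IsHadamard.dist_geodesic_le (hX : IsHadamard X) {p x y : X} {γ β : ℝ → X}
    (hγ0 : γ 0 = p) (hγ1 : γ 1 = x) (hγ : IsGeodesicOnWith dist γ (Icc 0 1) (dist p x))
    (hβ0 : β 0 = p) (hβ1 : β 1 = y) (hβ : IsGeodesicOnWith dist β (Icc 0 1) (dist p y))
    {s : ℝ} (hs : s ∈ Icc (0 : ℝ) 1) : dist (γ s) (β s) ≤ s * dist x y := by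
  have h0 : (0 : ℝ) ∈ Icc (0 : ℝ) 1 := by simp
  have h1 := hX.cat0 (γ s) p y β hβ0 hβ1 hβ s hs
  have h2 := hX.cat0 y p x γ hγ0 hγ1 hγ s hs
  have h3 : dist (γ s) p = dist p x * s := by
    have := hγ s hs 0 h0
    rwa [hγ0, sub_zero, abs_of_nonneg hs.1] at this
  rw [dist_comm y (γ s), dist_comm y p, dist_comm y x] at h2
  rw [h3] at h1
  have h4 : dist (γ s) (β s) ^ 2 ≤ (s * dist x y) ^ 2 := by
    nlinarith [mul_le_mul_of_nonneg_left h2 hs.1]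
  exact abs_le_of_sq_le_sq' h4 (mul_nonneg hs.1 dist_nonneg) |>.2

lemma IsHadamard.dist_le_div_mul (hX : IsHadamard X) {c c' : ℝ → X} {L t : ℝ} (hL : 0 < L)
    (hc : IsGeodesicOnWith dist c (Icc 0 L) 1) (hc' : IsGeodesicOnWith dist c' (Icc 0 L) 1)
    (h0 : c 0 = c' 0) (ht : t ∈ Icc 0 L) :
    dist (c t) (c' t) ≤ t / L * dist (c L) (c' L) := by
  have key : ∀ f : ℝ → X, IsGeodesicOnWith dist f (Icc 0 L) 1 →
      IsGeodesicOnWith dist (fun s => f (s * L)) (Icc 0 1) (dist (f 0) (f L)) := by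
    intro f hf s hs s' hs'
    have hm : ∀ r ∈ Icc (0 : ℝ) 1, r * L ∈ Icc 0 L := fun r hr =>
      ⟨mul_nonneg hr.1 hL.le, mul_le_of_le_one_left hL.le hr.2⟩
    rw [hf _ (hm s hs) _ (hm s' hs'), hf 0 ⟨le_rfl, hL.le⟩ L ⟨hL.le, le_rfl⟩, ← sub_mul,
      abs_mul, zero_sub, abs_neg, abs_of_pos hL]
    ring
  have hs : t / L ∈ Icc (0 : ℝ) 1 := ⟨div_nonneg ht.1 hL.le, (div_le_one hL).2 ht.2⟩
  have := hX.dist_geodesic_le (p := c 0) (x := c L) (y := c' L) (γ := fun s => c (s * L))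
    (β := fun s => c' (s * L)) (by simp) (by simp) (key c hc) (by simp [h0]) (by simp)
    (by simpa [h0] using key c' hc') hs
  simpa [div_mul_cancel₀ t hL.ne'] using this

/-- In a geodesic space, a ball is contained in a neighborhood of any smaller ball. -/
lemma IsGeodesicSpace.exists_dist_le (hX : IsGeodesicSpace X) {p x : X} {r ε : ℝ} (hr : 0 ≤ r)
    (hε : 0 ≤ ε) (hx : dist p x ≤ r + ε) : ∃ y, dist p y ≤ r ∧ dist y x ≤ ε := by
  rcases le_or_gt (dist p x) r with h | h
  · exact ⟨x, h, by simpa using hε⟩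
  obtain ⟨γ, h0, h1, hγ⟩ := hX p x
  have hd : 0 < dist p x := hr.trans_lt h
  have hs : r / dist p x ∈ Icc (0 : ℝ) 1 := ⟨div_nonneg hr hd.le, (div_le_one hd).2 h.le⟩
  refine ⟨γ (r / dist p x), ?_, ?_⟩
  · have := hγ 0 (by simp) _ hs
    rw [h0, zero_sub, abs_neg, abs_of_nonneg hs.1, mul_div_cancel₀ _ hd.ne'] at this
    exact this.le
  · have := hγ _ hs 1 (by simp)
    rw [h1, abs_of_nonpos (by linarith [hs.2]), neg_sub, mul_sub, mul_div_cancel₀ _ hd.ne'] at this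
    linarith

/-- The Hopf–Rinow theorem: a complete locally compact geodesic space is proper. -/
lemma IsGeodesicSpace.properSpace [CompleteSpace X] [LocallyCompactSpace X]
    (hX : IsGeodesicSpace X) : ProperSpace X := by
  refine ⟨fun p r => ?_⟩
  set S : Set ℝ := {r | 0 ≤ r ∧ IsCompact (Metric.closedBall p r)} with hS
  have h0 : (0 : ℝ) ∈ S := ⟨le_rfl, by simp⟩
  by_contra hr
  have hbd : BddAbove S := by
    refine ⟨r, fun t ht => ?_⟩
    by_contra! hlt
    exact hr (ht.2.of_isClosed_subset Metric.isClosed_closedBall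
      (Metric.closedBall_subset_closedBall hlt.le))
  set R := sSup S
  have hR0 : 0 ≤ R := le_csSup hbd h0
  have hlt : ∀ t < R, IsCompact (Metric.closedBall p t) := by
    intro t ht
    obtain ⟨t', ht', h⟩ := exists_lt_of_lt_csSup ⟨0, h0⟩ ht
    exact ht'.2.of_isClosed_subset Metric.isClosed_closedBall
      (Metric.closedBall_subset_closedBall h.le)
  have hRc : IsCompact (Metric.closedBall p R) := by
    rcases hR0.eq_or_lt with h | hpos
    · rw [← h]; exact h0.2
    refine TotallyBounded.isCompact_of_isClosed ?_ Metric.isClosed_closedBall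
    rw [Metric.totallyBounded_iff]
    intro ε hε
    set η := min (ε / 2) R
    have hη : 0 < η := lt_min (by linarith) hpos
    have hηε : η ≤ ε / 2 := min_le_left _ _
    obtain ⟨t, ht, hcov⟩ := Metric.totallyBounded_iff.1
      (hlt (R - η) (by linarith)).totallyBounded (ε / 2) (by linarith)
    refine ⟨t, ht, fun x hx => ?_⟩
    obtain ⟨y, hy, hyx⟩ := hX.exists_dist_le (p := p) (x := x) (r := R - η) (ε := η)
      (by linarith [min_le_right (ε / 2) R]) hη.le
      (by rw [sub_add_cancel, dist_comm]; exact hx)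
    have hy' := hcov (show y ∈ Metric.closedBall p (R - η) by
      rw [Metric.mem_closedBall, dist_comm]; exact hy)
    simp only [mem_iUnion, Metric.mem_ball, exists_prop] at hy' ⊢
    obtain ⟨z, hz, hyz⟩ := hy'
    exact ⟨z, hz, by linarith [dist_triangle x y z, dist_comm x y]⟩
  obtain ⟨δ, hδ, hcomp⟩ := hRc.exists_isCompact_cthickening
  have : R + δ ∈ S := by
    refine ⟨by linarith, hcomp.of_isClosed_subset Metric.isClosed_closedBall fun x hx => ?_⟩
    obtain ⟨y, hy, hyx⟩ := hX.exists_dist_le (p := p) (x := x) hR0 hδ.le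
      (by rw [dist_comm]; exact hx)
    exact Metric.mem_cthickening_of_dist_le x y δ _
      (by rw [Metric.mem_closedBall, dist_comm]; exact hy) (by rw [dist_comm]; exact hyx)
  linarith [le_csSup hbd this]

/-- In a visibility space, geodesics from a common point that are apart at a given time are
almost opposite at all large enough times, uniformly. -/
lemma IsVisibility.exists_uniform_spread [ProperSpace X] (hX : IsHadamard X)
    (hvis : IsVisibility X) (p : X) {a δ ε : ℝ} (ha : 0 < a) (hδ : 0 < δ) (hε : 0 < ε) :
    ∃ L₀ : ℝ, a ≤ L₀ ∧ ∀ L, L₀ ≤ L → ∀ c c' : ℝ → X, c 0 = p → c' 0 = p →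
      IsGeodesicOnWith dist c (Icc 0 L) 1 → IsGeodesicOnWith dist c' (Icc 0 L) 1 →
      δ ≤ dist (c a) (c' a) → (2 - ε) * L ≤ dist (c L) (c' L) := by
  by_contra! hcon
  choose L hL c c' hc0 hc0' hc hc' hδc hlt using fun n : ℕ => hcon (a + n) (by simp)
  have hLpos : ∀ n, 0 < L n := fun n => by
    have := hL n
    have : (0 : ℝ) ≤ n := n.cast_nonneg
    linarith
  have hLev : ∀ t : ℝ, ∀ᶠ n in (hyperfilter ℕ : Filter ℕ), t ≤ L n := by
    intro t
    have : ∀ᶠ n : ℕ in atTop, t ≤ L n := by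
      filter_upwards [eventually_ge_atTop ⌈t⌉₊] with n hn
      have h1 := hL n
      have h2 := Nat.ceil_le.1 hn
      linarith
    exact Nat.hyperfilter_le_atTop this
  have hlim : ∀ f : ℕ → ℝ → X, (∀ n, f n 0 = p) →
      (∀ n, IsGeodesicOnWith dist (f n) (Icc 0 (L n)) 1) →
      ∃ ρ : ℝ → X, ∀ t, 0 ≤ t →
        Tendsto (fun n => f n t) (hyperfilter ℕ : Filter ℕ) (𝓝 (ρ t)) := by
    intro f hf0 hf
    have : ∀ t : ℝ, ∃ x, 0 ≤ t →
        Tendsto (fun n => f n t) (hyperfilter ℕ : Filter ℕ) (𝓝 x) := by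
      intro t
      by_cases ht : 0 ≤ t
      · have hmem : ∀ᶠ n in (hyperfilter ℕ : Filter ℕ), f n t ∈ Metric.closedBall p t := by
          filter_upwards [hLev t] with n hn
          have := hf n t ⟨ht, hn⟩ 0 ⟨le_rfl, (hLpos n).le⟩
          rw [hf0, sub_zero, one_mul, abs_of_nonneg ht] at this
          exact this.le
        obtain ⟨x, -, hx⟩ := (isCompact_closedBall p t).ultrafilter_le_nhds
          ((hyperfilter ℕ).map fun n => f n t) (tendsto_principal.2 hmem)
        exact ⟨x, fun _ => hx⟩
      · exact ⟨p, fun h => absurd h ht⟩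
    choose ρ hρ using this
    exact ⟨ρ, fun t ht => hρ t ht⟩
  obtain ⟨ρ, hρ⟩ := hlim c hc0 hc
  obtain ⟨ρ', hρ'⟩ := hlim c' hc0' hc'
  have hray : ∀ f : ℕ → ℝ → X, ∀ σ : ℝ → X,
      (∀ n, IsGeodesicOnWith dist (f n) (Icc 0 (L n)) 1) →
      (∀ t, 0 ≤ t → Tendsto (fun n => f n t) (hyperfilter ℕ : Filter ℕ) (𝓝 (σ t))) →
      ∀ s t : ℝ, 0 ≤ s → 0 ≤ t → dist (σ s) (σ t) = |s - t| := by
    intro f σ hf hσ s t hs ht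
    refine tendsto_nhds_unique ((hσ s hs).dist (hσ t ht)) (tendsto_const_nhds.congr' ?_)
    filter_upwards [hLev s, hLev t] with n h1 h2
    rw [hf n s ⟨hs, h1⟩ t ⟨ht, h2⟩, one_mul]
  have hiso := hray c ρ hc hρ
  have hiso' := hray c' ρ' hc' hρ'
  have hconv : ∀ n, ∀ t ∈ Icc 0 (L n), dist (c n t) (c' n t) ≤ t / L n * dist (c n (L n))
      (c' n (L n)) := fun n t ht =>
    hX.dist_le_div_mul (hLpos n) (hc n) (hc' n) (by rw [hc0, hc0']) ht
  have hupper : ∀ t, 0 ≤ t → dist (ρ t) (ρ' t) ≤ (2 - ε) * t := by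
    intro t ht
    refine le_of_tendsto ((hρ t ht).dist (hρ' t ht)) ?_
    filter_upwards [hLev t] with n hn
    calc dist (c n t) (c' n t) ≤ t / L n * dist (c n (L n)) (c' n (L n)) := hconv n t ⟨ht, hn⟩
      _ ≤ t / L n * ((2 - ε) * L n) :=
          mul_le_mul_of_nonneg_left (hlt n).le (div_nonneg ht (hLpos n).le)
      _ = (2 - ε) * t := by field_simp [(hLpos n).ne']
  have hlower : δ ≤ dist (ρ a) (ρ' a) :=
    ge_of_tendsto ((hρ a ha.le).dist (hρ' a ha.le)) (Eventually.of_forall hδc)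
  have h00 : ρ 0 = ρ' 0 := by
    have h1 := hupper 0 le_rfl
    rw [mul_zero] at h1
    exact dist_le_zero.1 h1
  let α : UnitRay X := ⟨fun t => ρ t, fun s t => by
    rw [hiso s t s.2 t.2, NNReal.dist_eq]⟩
  let ω : UnitRay X := ⟨fun t => ρ' t, fun s t => by
    rw [hiso' s t s.2 t.2, NNReal.dist_eq]⟩
  have hne : ¬ AsymptoticMaps dist α.1 ω.1 := by
    rintro ⟨C, hC⟩
    set t : ℝ := max a (a * C / δ + 1)
    have hat : a ≤ t := le_max_left _ _
    have ht : 0 < t := ha.trans_le hat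
    have h1 := hX.dist_le_div_mul (c := ρ) (c' := ρ') ht
      (fun s hs s' hs' => by rw [hiso s s' hs.1 hs'.1, one_mul])
      (fun s hs s' hs' => by rw [hiso' s s' hs.1 hs'.1, one_mul]) h00 ⟨ha.le, hat⟩
    have h2 : dist (ρ t) (ρ' t) ≤ C := hC ⟨t, ht.le⟩
    have h3 : δ ≤ a / t * C :=
      hlower.trans (h1.trans (mul_le_mul_of_nonneg_left h2 (div_nonneg ha.le ht.le)))
    rw [div_mul_eq_mul_div, le_div_iff₀ ht] at h3
    have h4 : a * C / δ + 1 ≤ t := le_max_right _ _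
    have h5 : a * C < t * δ := (div_lt_iff₀ hδ).1 (by linarith)
    linarith
  obtain ⟨g, hg, ⟨C, hC⟩, ⟨C', hC'⟩⟩ := hvis α ω hne
  set t : ℝ := max 0 ((C + C') / ε + 1)
  have ht : 0 ≤ t := le_max_left _ _
  have h1 : dist (g (-t)) (ρ t) ≤ C := hC ⟨t, ht⟩
  have h2 : dist (g t) (ρ' t) ≤ C' := hC' ⟨t, ht⟩
  have h3 := hg (-t) t
  rw [abs_of_nonpos (by linarith)] at h3
  have h4 : (C + C') / ε + 1 ≤ t := le_max_right _ _
  have h5 : C + C' < t * ε := (div_lt_iff₀ hε).1 (by linarith)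
  have h6 := dist_triangle4_right (g (-t)) (g t) (ρ t) (ρ' t)
  linarith [hupper t ht]

/-- A choice of geodesics from `p` to every point of the space. -/
def IsGeodesicPencil (p : X) (h : ℝ → X → X) : Prop :=
  ∀ x, h 0 x = p ∧ h 1 x = x ∧ IsGeodesicOnWith dist (fun s => h s x) (Icc 0 1) (dist p x)

lemma IsGeodesicSpace.exists_pencil (hX : IsGeodesicSpace X) (p : X) :
    ∃ h : ℝ → X → X, IsGeodesicPencil p h := by
  choose γ h0 h1 hγ using hX p
  exact ⟨fun s x => γ x s, fun x => ⟨h0 x, h1 x, hγ x⟩⟩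

lemma IsGeodesicPencil.dist_le_mul (hX : IsHadamard X) {p : X} {h : ℝ → X → X}
    (hh : IsGeodesicPencil p h) {s : ℝ} (hs : s ∈ Icc (0 : ℝ) 1) (x y : X) :
    dist (h s x) (h s y) ≤ s * dist x y :=
  hX.dist_geodesic_le (hh x).1 (hh x).2.1 (hh x).2.2 (hh y).1 (hh y).2.1 (hh y).2.2 hs

lemma IsGeodesicPencil.continuous (hX : IsHadamard X) {p : X} {h : ℝ → X → X}
    (hh : IsGeodesicPencil p h) {s : ℝ} (hs : s ∈ Icc (0 : ℝ) 1) : Continuous (h s) :=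
  (LipschitzWith.of_dist_le_mul (K := ⟨s, hs.1⟩) (hh.dist_le_mul hX hs)).continuous

/-- Points at distance about `T` from `p` whose contractions at scale `a` are apart are
almost opposite with respect to `p`, provided that `T` is large enough. -/
lemma IsGeodesicPencil.exists_spread [ProperSpace X] (hX : IsHadamard X) (hvis : IsVisibility X)
    {p : X} {h : ℝ → X → X} (hh : IsGeodesicPencil p h) {a κ : ℝ} (ha : 0 < a) (hκ : 0 < κ)
    (hκ1 : κ < 1) :
    ∃ T₀ : ℝ, ∀ T, T₀ ≤ T → ∀ x y : X, |dist p x - T| ≤ κ * T → |dist p y - T| ≤ κ * T →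
      3 * κ * a ≤ dist (h (a / T) x) (h (a / T) y) → (2 - 7 * κ) * T ≤ dist x y := by
  obtain ⟨L₀, haL₀, hL₀⟩ := hvis.exists_uniform_spread hX p ha (mul_pos hκ ha) hκ
  have hκ' : 0 < 1 - κ := sub_pos.2 hκ1
  refine ⟨L₀ / (1 - κ), fun T hT x y hx hy hxy => ?_⟩
  set L := (1 - κ) * T with hL
  have hL₀L : L₀ ≤ L := by
    rw [div_le_iff₀ hκ'] at hT
    linarith
  have haL : a ≤ L := haL₀.trans hL₀L
  have hLpos : 0 < L := ha.trans_le haL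
  have hT0 : 0 < T := pos_of_mul_pos_right hLpos hκ'.le
  have haT : a / T ∈ Icc (0 : ℝ) 1 :=
    ⟨div_nonneg ha.le hT0.le, (div_le_one hT0).2 (by nlinarith)⟩
  have key : ∀ z : X, |dist p z - T| ≤ κ * T →
      IsGeodesicOnWith dist (fun t => h (t / dist p z) z) (Icc 0 L) 1 ∧
      dist (h (a / dist p z) z) (h (a / T) z) ≤ κ * a ∧
      dist (h (L / dist p z) z) z ≤ 2 * κ * T := by
    intro z hz
    have hz' := abs_le.1 hz
    have hLr : L ≤ dist p z := by rw [hL]; linarith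
    have hr : 0 < dist p z := hLpos.trans_le hLr
    have hm : ∀ t ∈ Icc 0 L, t / dist p z ∈ Icc (0 : ℝ) 1 := fun t ht =>
      ⟨div_nonneg ht.1 hr.le, (div_le_one hr).2 (ht.2.trans hLr)⟩
    refine ⟨fun t ht t' ht' => ?_, ?_, ?_⟩
    · have := (hh z).2.2 _ (hm t ht) _ (hm t' ht')
      rw [this, ← sub_div, abs_div, abs_of_pos hr]
      field_simp
    · have := (hh z).2.2 _ (hm a ⟨ha.le, haL⟩) _ haT
      rw [this, ← abs_of_pos hr, ← abs_mul, abs_of_pos hr]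
      have e : dist p z * (a / dist p z - a / T) = - (a / T * (dist p z - T)) := by
        field_simp
        ring
      rw [e, abs_neg, abs_mul, abs_of_nonneg haT.1]
      calc a / T * |dist p z - T| ≤ a / T * (κ * T) := mul_le_mul_of_nonneg_left hz haT.1
        _ = κ * a := by field_simp
    · have := (hh z).2.2 _ (hm L ⟨hLpos.le, le_rfl⟩) 1 (by simp)
      simp only [(hh z).2.1] at this
      rw [this, abs_of_nonpos (by linarith [(hm L ⟨hLpos.le, le_rfl⟩).2]), neg_sub, mul_sub,
        mul_div_cancel₀ _ hr.ne']
      linarith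
  obtain ⟨hgx, hax, hLx⟩ := key x hx
  obtain ⟨hgy, hay, hLy⟩ := key y hy
  have h1 := hL₀ L hL₀L _ _ (by simp [(hh x).1]) (by simp [(hh y).1]) hgx hgy (by
    have := dist_triangle4_left (h (a / dist p x) x) (h (a / dist p y) y) (h (a / T) x)
      (h (a / T) y)
    linarith)
  have h2 := dist_triangle4 (h (L / dist p x) x) x y (h (L / dist p y) y)
  rw [dist_comm y] at h2
  nlinarith [mul_pos (mul_pos hκ hκ) hT0]

end HadamardGeometry

/-- An almost-ultrametric inequality for the distances `D₀₁, D₁₂, D₀₂` between three points at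
distances `r₀, r₁, r₂` from a base point. -/
lemma sq_le_of_spread {D₀₁ D₁₂ D₀₂ r₀ r₁ r₂ g₀₁ g₁₂ κ T : ℝ} (hκ : 0 < κ) (hκ1 : κ ≤ 1 / 10)
    (hT : 0 < T) (hD₀₂ : 0 ≤ D₀₂) (hg₀₁ : 0 ≤ g₀₁)
    (hg₁₂ : 0 ≤ g₁₂) (htri : D₀₂ ≤ D₀₁ + D₁₂) (hr : D₀₂ ≤ r₀ + r₂) (h₀₁ : g₀₁ ≤ D₀₁)
    (h₁₂ : g₁₂ ≤ D₁₂)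
    (hs₀₁ : |r₀ - T| ≤ κ * T → |r₁ - T| ≤ κ * T → 3 * κ * T ≤ g₀₁ → (2 - 7 * κ) * T ≤ D₀₁)
    (hs₁₂ : |r₁ - T| ≤ κ * T → |r₂ - T| ≤ κ * T → 3 * κ * T ≤ g₁₂ → (2 - 7 * κ) * T ≤ D₁₂) :
    D₀₂ ^ 2 ≤ D₀₁ ^ 2 + D₁₂ ^ 2 + 76 * κ * T ^ 2 + 2 * (D₀₁ ^ 2 - g₀₁ ^ 2) +
      2 * (D₁₂ ^ 2 - g₁₂ ^ 2) +
      (8 / κ ^ 2 + 4) * ((r₀ - T) ^ 2 + (r₁ - T) ^ 2 + (r₂ - T) ^ 2) := by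
  have q₀₁ : 0 ≤ D₀₁ ^ 2 - g₀₁ ^ 2 := by nlinarith
  have q₁₂ : 0 ≤ D₁₂ ^ 2 - g₁₂ ^ 2 := by nlinarith
  have hT2 : 0 < κ * T ^ 2 := by positivity
  by_cases hgood : |r₀ - T| ≤ κ * T ∧ |r₁ - T| ≤ κ * T ∧ |r₂ - T| ≤ κ * T
  · obtain ⟨b₀, b₁, b₂⟩ := hgood
    have hQ : 0 ≤ (8 / κ ^ 2 + 4) * ((r₀ - T) ^ 2 + (r₁ - T) ^ 2 + (r₂ - T) ^ 2) := by
      positivity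
    have hup : D₀₂ ^ 2 ≤ ((2 + 2 * κ) * T) ^ 2 := by
      have := (abs_le.1 b₀).2
      have := (abs_le.1 b₂).2
      exact pow_le_pow_left₀ hD₀₂ (by linarith) 2
    have hfar : ∀ D : ℝ, (2 - 7 * κ) * T ≤ D → D₀₂ ^ 2 ≤ D ^ 2 + 76 * κ * T ^ 2 := by
      intro D hD
      have h1 : ((2 - 7 * κ) * T) ^ 2 ≤ D ^ 2 :=
        pow_le_pow_left₀ (mul_nonneg (by linarith) hT.le) hD 2
      nlinarith [mul_pos hκ hT2]
    by_cases c₀₁ : 3 * κ * T ≤ g₀₁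
    · linarith [hfar _ (hs₀₁ b₀ b₁ c₀₁), sq_nonneg D₁₂]
    by_cases c₁₂ : 3 * κ * T ≤ g₁₂
    · linarith [hfar _ (hs₁₂ b₁ b₂ c₁₂), sq_nonneg D₀₁]
    push Not at c₀₁ c₁₂
    have e₀₁ : g₀₁ ^ 2 ≤ (3 * κ * T) ^ 2 := pow_le_pow_left₀ hg₀₁ c₀₁.le 2
    have e₁₂ : g₁₂ ^ 2 ≤ (3 * κ * T) ^ 2 := pow_le_pow_left₀ hg₁₂ c₁₂.le 2
    have e : (3 * κ * T) ^ 2 ≤ κ * T ^ 2 := by nlinarith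
    have : D₀₂ ^ 2 ≤ (D₀₁ + D₁₂) ^ 2 := pow_le_pow_left₀ hD₀₂ htri 2
    nlinarith [sq_nonneg (D₀₁ - D₁₂), sq_nonneg D₀₁, sq_nonneg D₁₂]
  · have hbad : (κ * T) ^ 2 ≤ (r₀ - T) ^ 2 + (r₁ - T) ^ 2 + (r₂ - T) ^ 2 := by
      have hκT : 0 ≤ κ * T := by positivity
      have key : ∀ r : ℝ, ¬ |r - T| ≤ κ * T → (κ * T) ^ 2 ≤ (r - T) ^ 2 := fun r hr => by
        rw [← sq_abs (r - T)]
        exact pow_le_pow_left₀ hκT (not_le.1 hr).le 2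
      by_cases b₀ : |r₀ - T| ≤ κ * T
      · by_cases b₁ : |r₁ - T| ≤ κ * T
        · have := key r₂ fun b₂ => hgood ⟨b₀, b₁, b₂⟩
          linarith [sq_nonneg (r₀ - T), sq_nonneg (r₁ - T)]
        · linarith [key r₁ b₁, sq_nonneg (r₀ - T), sq_nonneg (r₂ - T)]
      · linarith [key r₀ b₀, sq_nonneg (r₁ - T), sq_nonneg (r₂ - T)]
    have hbad' : 8 * T ^ 2 ≤ 8 / κ ^ 2 * ((r₀ - T) ^ 2 + (r₁ - T) ^ 2 + (r₂ - T) ^ 2) :=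
      calc 8 * T ^ 2 = 8 / κ ^ 2 * (κ * T) ^ 2 := by field_simp
        _ ≤ _ := mul_le_mul_of_nonneg_left hbad (by positivity)
    have : D₀₂ ^ 2 ≤ (r₀ + r₂) ^ 2 := pow_le_pow_left₀ hD₀₂ hr 2
    nlinarith [sq_nonneg (r₀ - r₂), sq_nonneg (r₀ - 2 * T), sq_nonneg (r₂ - 2 * T),
      sq_nonneg (r₁ - T), sq_nonneg D₀₁, sq_nonneg D₁₂]
/-! ## Couplings -/

section Couplings

lemma IsCoupling.isProbabilityMeasure {A B : Type*} [MeasurableSpace A] [MeasurableSpace B]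
    {π : Measure (A × B)} {μ : Measure A} {ν : Measure B} (h : IsCoupling π μ ν)
    [IsProbabilityMeasure μ] : IsProbabilityMeasure π := by
  refine ⟨?_⟩
  rw [← measure_univ (μ := μ), ← h.1, Measure.map_apply measurable_fst .univ, preimage_univ]

/-- The gluing lemma: two transport plans sharing a marginal come from a common measure. -/
lemma exists_gluing {A B C : Type*} [MeasurableSpace A] [MeasurableSpace B] [MeasurableSpace C]
    [StandardBorelSpace C] [Nonempty C] (π : Measure (A × B)) (π' : Measure (B × C))
    [IsProbabilityMeasure π] [IsProbabilityMeasure π']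
    (h : π.map Prod.snd = π'.map Prod.fst) :
    ∃ Θ : Measure ((A × B) × C), Θ.map Prod.fst = π ∧
      Θ.map (fun z : (A × B) × C => (z.1.2, z.2)) = π' := by
  refine ⟨π.compProd (π'.condKernel.comap Prod.snd measurable_snd), Measure.fst_compProd _ _, ?_⟩
  conv_rhs => rw [← π'.disintegrate π'.condKernel]
  ext s hs
  have hm : Measurable fun z : (A × B) × C => (z.1.2, z.2) := by fun_prop
  rw [Measure.map_apply hm hs, Measure.compProd_apply (hm hs), Measure.compProd_apply hs,
    Measure.fst, ← h, lintegral_map (ProbabilityTheory.Kernel.measurable_kernel_prodMk_left hs)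
      measurable_snd]
  rfl

variable {X : Type*} [MetricSpace X] [MeasurableSpace X]

lemma W2Space.isCoupling_prod (μ ν : W2Space X) : IsCoupling (μ.1.prod ν.1) μ.1 ν.1 := by
  have := μ.2.1
  have := ν.2.1
  exact ⟨by simp [Measure.map_fst_prod], by simp [Measure.map_snd_prod]⟩

lemma Wdist_sq_eq (μ ν : W2Space X) : Wdist μ ν ^ 2 = (W2cost μ.1 ν.1).toReal :=
  Real.sq_sqrt ENNReal.toReal_nonneg

/-- The second moment of a measure about `p`. -/
def W2Space.moment (p : X) (μ : W2Space X) : ℝ := ∫ x, dist p x ^ 2 ∂μ.1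

lemma W2Space.moment_nonneg (p : X) (μ : W2Space X) : 0 ≤ μ.moment p :=
  integral_nonneg fun _ => sq_nonneg _

variable [BorelSpace X] [SecondCountableTopology X]

lemma W2Space.integrable_dist_sq (μ : W2Space X) (p : X) :
    Integrable (fun x => dist p x ^ 2) μ.1 := by
  obtain ⟨μ, hμ, x₀, hx₀⟩ := μ
  have h₀ : Integrable (fun x => dist x₀ x ^ 2) μ := by
    refine ⟨by fun_prop, ?_⟩
    rw [hasFiniteIntegral_iff_ofReal (Eventually.of_forall fun x => sq_nonneg _)]
    simpa only [ENNReal.ofReal_pow dist_nonneg] using hx₀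
  refine Integrable.mono' (g := fun x => 2 * dist p x₀ ^ 2 + 2 * dist x₀ x ^ 2)
    ((integrable_const _).add (h₀.const_mul 2)) (by fun_prop) (Eventually.of_forall fun x => ?_)
  rw [Real.norm_of_nonneg (sq_nonneg _)]
  have := pow_le_pow_left₀ dist_nonneg (dist_triangle p x₀ x) 2
  nlinarith [sq_nonneg (dist p x₀ - dist x₀ x)]

/-- The squared distance between two measurable maps of square-integrable law is integrable. -/
lemma integrable_sq_dist_comp {Z : Type*} [MeasurableSpace Z] {Θ : Measure Z} {f g : Z → X} (p : X)
    (hf : Measurable f) (hg : Measurable g) (hfi : Integrable (fun z => dist p (f z) ^ 2) Θ)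
    (hgi : Integrable (fun z => dist p (g z) ^ 2) Θ) :
    Integrable (fun z => dist (f z) (g z) ^ 2) Θ := by
  refine Integrable.mono' ((hfi.const_mul 2).add (hgi.const_mul 2))
    ((hf.dist hg).pow_const 2).aestronglyMeasurable (Eventually.of_forall fun z => ?_)
  rw [Real.norm_of_nonneg (sq_nonneg _)]
  have := pow_le_pow_left₀ dist_nonneg (dist_triangle_left (f z) (g z) p) 2
  simp only [Pi.add_apply]
  nlinarith [sq_nonneg (dist p (f z) - dist p (g z))]

/-- `f` has law `μ` under `Θ`. -/
lemma W2Space.integrable_comp {Z : Type*} [MeasurableSpace Z] {Θ : Measure Z} {f : Z → X}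
    (hf : Measurable f) {μ : W2Space X} (h : Θ.map f = μ.1) (p : X) :
    Integrable (fun z => dist p (f z) ^ 2) Θ := by
  have := μ.integrable_dist_sq p
  rw [← h] at this
  exact this.comp_measurable hf

lemma W2cost_toReal {μ ν : W2Space X} (p : X) {π : Measure (X × X)} (h : IsCoupling π μ.1 ν.1) :
    ∫⁻ z, ENNReal.ofReal (dist z.1 z.2) ^ 2 ∂π = ENNReal.ofReal (∫ z, dist z.1 z.2 ^ 2 ∂π) := by
  rw [ofReal_integral_eq_lintegral_ofReal (integrable_sq_dist_comp p measurable_fst measurable_snd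
    (W2Space.integrable_comp measurable_fst h.1 p) (W2Space.integrable_comp measurable_snd h.2 p))
    (Eventually.of_forall fun z => sq_nonneg _)]
  simp only [ENNReal.ofReal_pow dist_nonneg]

lemma IsCoupling.Wdist_sq_le {μ ν : W2Space X} (p : X) {π : Measure (X × X)}
    (h : IsCoupling π μ.1 ν.1) : Wdist μ ν ^ 2 ≤ ∫ z, dist z.1 z.2 ^ 2 ∂π := by
  rw [Wdist_sq_eq]
  refine ENNReal.toReal_le_of_le_ofReal (integral_nonneg fun z => sq_nonneg _) ?_
  rw [← W2cost_toReal p h]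
  exact iInf₂_le π h

lemma Wdist_sq_le_integral {Z : Type*} [MeasurableSpace Z] {Θ : Measure Z} {μ ν : W2Space X}
    (p : X) {f g : Z → X} (hf : Measurable f) (hg : Measurable g) (hfμ : Θ.map f = μ.1)
    (hgν : Θ.map g = ν.1) : Wdist μ ν ^ 2 ≤ ∫ z, dist (f z) (g z) ^ 2 ∂Θ := by
  have hfg : Measurable fun z => (f z, g z) := hf.prodMk hg
  have h : IsCoupling (Θ.map fun z => (f z, g z)) μ.1 ν.1 :=
    ⟨by rw [Measure.map_map measurable_fst hfg]; exact hfμ,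
      by rw [Measure.map_map measurable_snd hfg]; exact hgν⟩
  refine (h.Wdist_sq_le p).trans_eq ?_
  rw [integral_map hfg.aemeasurable
    ((measurable_fst.dist measurable_snd).pow_const 2).aestronglyMeasurable]

lemma exists_isCoupling_le (μ ν : W2Space X) (p : X) {η : ℝ} (hη : 0 < η) :
    ∃ π : Measure (X × X), IsCoupling π μ.1 ν.1 ∧
      ∫ z, dist z.1 z.2 ^ 2 ∂π ≤ Wdist μ ν ^ 2 + η := by
  have hfin : W2cost μ.1 ν.1 ≠ ⊤ := by
    have h := W2Space.isCoupling_prod μ ν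
    exact ne_top_of_le_ne_top ENNReal.ofReal_ne_top
      ((iInf₂_le (μ.1.prod ν.1) h).trans_eq (W2cost_toReal p h))
  have hlt : W2cost μ.1 ν.1 < ENNReal.ofReal (Wdist μ ν ^ 2 + η) := by
    rw [Wdist_sq_eq, ENNReal.lt_ofReal_iff_toReal_lt hfin]
    linarith
  simp only [W2cost, iInf_lt_iff] at hlt
  obtain ⟨π, hπ, h⟩ := hlt
  refine ⟨π, hπ, ?_⟩
  rw [W2cost_toReal p hπ] at h
  exact ((ENNReal.ofReal_lt_ofReal_iff (by positivity)).1 h).le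

lemma integral_sq_le_of_le_add {Z : Type*} [MeasurableSpace Z] {Θ : Measure Z} {f g k : Z → ℝ}
    (hf : ∀ z, 0 ≤ f z) (h : ∀ z, f z ≤ g z + k z)
    (hfi : Integrable (fun z => f z ^ 2) Θ) (hgi : Integrable (fun z => g z ^ 2) Θ)
    (hki : Integrable (fun z => k z ^ 2) Θ) {θ : ℝ} (hθ : 0 < θ) :
    ∫ z, f z ^ 2 ∂Θ ≤ (1 + θ) * ∫ z, g z ^ 2 ∂Θ + (1 + 1 / θ) * ∫ z, k z ^ 2 ∂Θ := by
  rw [← integral_const_mul, ← integral_const_mul,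
    ← integral_add (hgi.const_mul _) (hki.const_mul _)]
  refine integral_mono hfi ((hgi.const_mul _).add (hki.const_mul _)) fun z => ?_
  have h1 := pow_le_pow_left₀ (hf z) (h z) 2
  have h2 : (1 + θ) * g z ^ 2 + (1 + 1 / θ) * k z ^ 2 - (g z + k z) ^ 2 =
      (θ * g z - k z) ^ 2 / θ := by
    field_simp
    ring
  have h3 : 0 ≤ (θ * g z - k z) ^ 2 / θ := by positivity
  simp only
  linarith

lemma W2Space.integral_comp {Z : Type*} [MeasurableSpace Z] {Θ : Measure Z} {f : Z → X}
    (hf : Measurable f) {μ : W2Space X} (h : Θ.map f = μ.1) (p : X) :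
    ∫ z, dist p (f z) ^ 2 ∂Θ = μ.moment p := by
  rw [W2Space.moment, ← h, integral_map hf.aemeasurable (by fun_prop)]

lemma W2Space.moment_le (p : X) (μ ν : W2Space X) {θ : ℝ} (hθ : 0 < θ) :
    ν.moment p ≤ (1 + θ) * Wdist μ ν ^ 2 + (1 + 1 / θ) * μ.moment p := by
  refine le_of_forall_pos_le_add fun ε hε => ?_
  have hθ' : 0 < 1 + θ := by linarith
  obtain ⟨π, hπ, hle⟩ := exists_isCoupling_le μ ν p (div_pos hε hθ')
  have i1 := W2Space.integrable_comp measurable_fst hπ.1 p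
  have i2 := W2Space.integrable_comp measurable_snd hπ.2 p
  have := integral_sq_le_of_le_add (Θ := π) (f := fun z => dist p z.2)
    (g := fun z => dist z.1 z.2) (k := fun z => dist p z.1) (fun _ => dist_nonneg)
    (fun z => by linarith [dist_triangle p z.1 z.2]) i2
    (integrable_sq_dist_comp p measurable_fst measurable_snd i1 i2) i1 hθ
  rw [W2Space.integral_comp measurable_snd hπ.2, W2Space.integral_comp measurable_fst hπ.1] at this
  have h2 := mul_le_mul_of_nonneg_left hle hθ'.le
  rw [mul_add, mul_div_cancel₀ _ hθ'.ne'] at h2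
  linarith

lemma W2Space.Wdist_sq_le_moment (p : X) (μ ν : W2Space X) {θ : ℝ} (hθ : 0 < θ) :
    Wdist μ ν ^ 2 ≤ (1 + θ) * ν.moment p + (1 + 1 / θ) * μ.moment p := by
  have hπ := W2Space.isCoupling_prod μ ν
  have i1 := W2Space.integrable_comp measurable_fst hπ.1 p
  have i2 := W2Space.integrable_comp measurable_snd hπ.2 p
  have := integral_sq_le_of_le_add (f := fun z : X × X => dist z.1 z.2)
    (g := fun z => dist p z.2) (k := fun z => dist p z.1) (fun _ => dist_nonneg)
    (fun z => by linarith [dist_triangle_left z.1 z.2 p])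
    (integrable_sq_dist_comp p measurable_fst measurable_snd i1 i2) i2 i1 hθ
  rw [W2Space.integral_comp measurable_snd hπ.2, W2Space.integral_comp measurable_fst hπ.1] at this
  exact (hπ.Wdist_sq_le p).trans this

/-- In an isometric image of a normed space, second moments grow like the squared norm. -/
lemma exists_moment_bound {E : Type*} [NormedAddCommGroup E] {φ : E → W2Space X}
    (hφ : ∀ u v, Wdist (φ u) (φ v) = dist u v) (p : X) :
    ∃ K : ℝ, 0 < K ∧ ∀ v, |(φ v).moment p - ‖v‖ ^ 2| ≤ K * (1 + ‖v‖) := by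
  set M := (φ 0).moment p
  have hM : 0 ≤ M := W2Space.moment_nonneg p _
  refine ⟨1 + 4 * M, by linarith, fun v => ?_⟩
  have hn := norm_nonneg v
  set n := ‖v‖
  have hW : Wdist (φ 0) (φ v) = n := by rw [hφ, dist_zero_left]
  have hθ : 0 < 1 / (1 + n) := by positivity
  have h1 := W2Space.moment_le p (φ 0) (φ v) hθ
  have h2 := W2Space.Wdist_sq_le_moment p (φ 0) (φ v) hθ
  rw [hW, one_div_one_div] at h1 h2
  set N := (φ v).moment p
  have e1 : 1 / (1 + n) * n ^ 2 ≤ n := by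
    rw [one_div_mul_eq_div, div_le_iff₀ (by linarith)]
    nlinarith
  have hN : N ≤ n ^ 2 + (1 + 2 * M) * (1 + n) := by nlinarith
  have e2 : 1 / (1 + n) * N ≤ n + (1 + 2 * M) := by
    rw [one_div_mul_eq_div, div_le_iff₀ (by linarith)]
    nlinarith
  rw [abs_le]
  constructor <;> nlinarith [mul_nonneg hM hn]

/-- If two measures are at the maximal distance `2T` allowed by their second moments, then
they are concentrated near a sphere of radius `T`. -/
lemma W2Space.integral_dist_sub_sq_le (p : X) {μ ν : W2Space X} {T B : ℝ} (hT : 0 ≤ T) (hB : 0 ≤ B)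
    (hW : Wdist μ ν = 2 * T) (hμ : μ.moment p ≤ T ^ 2 + B) (hν : ν.moment p ≤ T ^ 2 + B) :
    Integrable (fun x => (dist p x - T) ^ 2) μ.1 ∧ ∫ x, (dist p x - T) ^ 2 ∂μ.1 ≤ 6 * B := by
  have := μ.2.1
  have := ν.2.1
  have hdi : ∀ ρ : W2Space X, Integrable (fun x => dist p x) ρ.1 := fun ρ => by
    have := ρ.2.1
    refine Integrable.mono' ((integrable_const 1).add (ρ.integrable_dist_sq p)) (by fun_prop)
      (Eventually.of_forall fun x => ?_)
    rw [Real.norm_of_nonneg dist_nonneg]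
    simp only [Pi.add_apply]
    nlinarith [sq_nonneg (dist p x - 1), dist_nonneg (x := p) (y := x)]
  have hexp : ∀ ρ : W2Space X, Integrable (fun x => (dist p x - T) ^ 2) ρ.1 ∧
      ∫ x, (dist p x - T) ^ 2 ∂ρ.1 = ρ.moment p - 2 * T * ∫ x, dist p x ∂ρ.1 + T ^ 2 := by
    intro ρ
    have := ρ.2.1
    have e : (fun x => (dist p x - T) ^ 2) =
        fun x => dist p x ^ 2 - 2 * T * dist p x + T ^ 2 := by
      funext x
      ring
    have i1 := ρ.integrable_dist_sq p
    have i2 := (hdi ρ).const_mul (2 * T)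
    have i12 : Integrable (fun x => dist p x ^ 2 - 2 * T * dist p x) ρ.1 := i1.sub i2
    rw [e]
    refine ⟨i12.add (integrable_const _), ?_⟩
    rw [integral_add i12 (integrable_const _), integral_sub i1 i2, integral_const_mul,
      integral_const]
    simp [W2Space.moment]
  refine ⟨(hexp μ).1, ?_⟩
  set m := ∫ x, dist p x ∂μ.1 with hm
  set m' := ∫ x, dist p x ∂ν.1 with hm'
  have hm0 : 0 ≤ m := integral_nonneg fun _ => dist_nonneg
  have hm0' : 0 ≤ m' := integral_nonneg fun _ => dist_nonneg
  have hπ := W2Space.isCoupling_prod μ ν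
  have i1 := W2Space.integrable_comp measurable_fst hπ.1 p
  have i2 := W2Space.integrable_comp measurable_snd hπ.2 p
  have i3 : Integrable (fun z : X × X => dist p z.1 * dist p z.2) (μ.1.prod ν.1) :=
    (hdi μ).mul_prod (hdi ν)
  have i12 : Integrable (fun z : X × X => dist p z.1 ^ 2 + dist p z.2 ^ 2) (μ.1.prod ν.1) :=
    i1.add i2
  have hprod : (2 * T) ^ 2 ≤ μ.moment p + ν.moment p + 2 * (m * m') := by
    rw [← hW, ← W2Space.integral_comp measurable_fst hπ.1 p,
      ← W2Space.integral_comp measurable_snd hπ.2 p, hm, hm', ← integral_prod_mul,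
      ← integral_const_mul, ← integral_add i1 i2, ← integral_add i12 (i3.const_mul 2)]
    refine (hπ.Wdist_sq_le p).trans (integral_mono
      (integrable_sq_dist_comp p measurable_fst measurable_snd i1 i2)
      (i12.add (i3.const_mul 2)) fun z => ?_)
    have := pow_le_pow_left₀ dist_nonneg (dist_triangle_left z.1 z.2 p) 2
    simp only
    linarith
  have hA : T ^ 2 - B ≤ m * m' := by linarith
  have hfin : 2 * (T ^ 2 - B) ≤ T * (m + m') := by
    rcases le_or_gt (T ^ 2 - B) 0 with h | h
    · linarith [mul_nonneg hT (add_nonneg hm0 hm0')]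
    · refine abs_le_of_sq_le_sq' ?_ (mul_nonneg hT (add_nonneg hm0 hm0')) |>.2
      have h1 : (T ^ 2 - B) ^ 2 ≤ T ^ 2 * (m * m') := by nlinarith
      nlinarith [mul_nonneg (sq_nonneg T) (sq_nonneg (m - m'))]
  have hnn : 0 ≤ ∫ x, (dist p x - T) ^ 2 ∂ν.1 := integral_nonneg fun _ => sq_nonneg _
  rw [(hexp ν).2] at hnn
  rw [(hexp μ).2]
  linarith

end Couplings
/-! ## Contracting an isometric image of a normed space -/

section Contraction

variable {X : Type*} [MetricSpace X] [MeasurableSpace X] [BorelSpace X]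
  [SecondCountableTopology X]

/-- If `μ`, `ν` look like the points at distance `a` and `T` on a Wasserstein ray, then `μ` is
close to the image of `ν` by the contraction towards `p` with ratio `a / T`. -/
lemma IsGeodesicPencil.exists_isCoupling_contraction (hX : IsHadamard X) {p : X} {h : ℝ → X → X}
    (hh : IsGeodesicPencil p h) {μ ν : W2Space X} {a T K : ℝ} (ha : 0 < a) (haT : a ≤ T)
    (hK : 0 < K) (hW : Wdist μ ν = T - a) (hμ : μ.moment p ≤ a ^ 2 + K * (1 + a))
    (hν : T ^ 2 - K * (1 + T) ≤ ν.moment p) :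
    ∃ π : Measure (X × X), IsCoupling π μ.1 ν.1 ∧
      ∫ z, dist z.1 (h (a / T) z.2) ^ 2 ∂π ≤ 2 * K * (1 + a) + 1 := by
  obtain ⟨π, hπ, hle⟩ := exists_isCoupling_le μ ν p one_pos
  rw [hW] at hle
  refine ⟨π, hπ, ?_⟩
  have hT : 0 < T := ha.trans_le haT
  have hs : a / T ∈ Icc (0 : ℝ) 1 := ⟨div_nonneg ha.le hT.le, (div_le_one hT).2 haT⟩
  have hsT : a / T * T = a := div_mul_cancel₀ a hT.ne'
  set s := a / T
  have i1 := W2Space.integrable_comp measurable_fst hπ.1 p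
  have i2 := W2Space.integrable_comp measurable_snd hπ.2 p
  have i3 := integrable_sq_dist_comp p measurable_fst measurable_snd i1 i2
  have j1 : Integrable (fun z : X × X => (1 - s) * dist p z.1 ^ 2 + s * dist z.1 z.2 ^ 2) π :=
    (i1.const_mul (1 - s)).add (i3.const_mul s)
  have j2 : Integrable (fun z : X × X => s * (1 - s) * dist p z.2 ^ 2) π :=
    i2.const_mul (s * (1 - s))
  have key : ∫ z, dist z.1 (h s z.2) ^ 2 ∂π ≤
      (1 - s) * μ.moment p + s * ∫ z, dist z.1 z.2 ^ 2 ∂π - s * (1 - s) * ν.moment p := by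
    rw [← W2Space.integral_comp measurable_fst hπ.1, ← W2Space.integral_comp measurable_snd hπ.2,
      ← integral_const_mul, ← integral_const_mul, ← integral_const_mul,
      ← integral_add (i1.const_mul (1 - s)) (i3.const_mul s), ← integral_sub j1 j2]
    refine integral_mono_of_nonneg (Eventually.of_forall fun z => sq_nonneg _) (j1.sub j2)
      (Eventually.of_forall fun z => ?_)
    have := hX.cat0 z.1 p z.2 _ (hh z.2).1 (hh z.2).2.1 (hh z.2).2.2 s hs
    rwa [dist_comm z.1 p] at this
  have hs1 : 0 ≤ 1 - s := sub_nonneg.2 hs.2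
  have e1 := mul_le_mul_of_nonneg_left hμ hs1
  have e2 := mul_le_mul_of_nonneg_left hle hs.1
  have e3 := mul_le_mul_of_nonneg_left hν (mul_nonneg hs.1 hs1)
  have e4 : (1 - s) * a ^ 2 + s * (T - a) ^ 2 - s * (1 - s) * T ^ 2 = 0 := by
    rw [← hsT]
    ring
  have e5 : (1 - s) * (K * (1 + a)) ≤ K * (1 + a) :=
    mul_le_of_le_one_left (by positivity) (by linarith [hs.1])
  have e6 : s * (1 - s) * (K * (1 + T)) ≤ K * (1 + a) := by
    have : s * (1 + T) ≤ 1 + a := by linarith [hs.2]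
    calc s * (1 - s) * (K * (1 + T)) = (1 - s) * (K * (s * (1 + T))) := by ring
      _ ≤ (1 - s) * (K * (1 + a)) := by gcongr
      _ ≤ K * (1 + a) := e5
  linarith [hs.2]

/-- The distance between two measures is controlled by the transport between contractions of
other measures. -/
lemma Wdist_sq_le_contraction {p : X} [StandardBorelSpace X] {f : X → X}
    (hf : Measurable f) (hfp : ∀ x, dist p (f x) ≤ dist p x) {μ₀ μ₁ ν₀ ν₁ : W2Space X}
    {π₀ π₁ π : Measure (X × X)} (h₀ : IsCoupling π₀ μ₀.1 ν₀.1) (h₁ : IsCoupling π₁ μ₁.1 ν₁.1)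
    (h : IsCoupling π ν₀.1 ν₁.1) {B θ : ℝ} (hθ : 0 < θ)
    (hB₀ : ∫ z, dist z.1 (f z.2) ^ 2 ∂π₀ ≤ B) (hB₁ : ∫ z, dist z.1 (f z.2) ^ 2 ∂π₁ ≤ B) :
    Wdist μ₀ μ₁ ^ 2 ≤
      (1 + θ) * ∫ z, dist (f z.1) (f z.2) ^ 2 ∂π + (1 + 1 / θ) * (4 * B) := by
  have := μ₀.2.1
  have := μ₁.2.1
  have := ν₀.2.1
  have : Nonempty X := ⟨p⟩
  have := h₀.isProbabilityMeasure
  have := h₁.isProbabilityMeasure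
  have := h.isProbabilityMeasure
  have : IsProbabilityMeasure (π₁.map Prod.swap) :=
    Measure.isProbabilityMeasure_map measurable_swap.aemeasurable
  obtain ⟨Θ, hΘ₀, hΘ⟩ := exists_gluing π₀ π (h₀.2.trans h.1.symm)
  have : IsProbabilityMeasure Θ := IsCoupling.isProbabilityMeasure (μ := π₀) ⟨hΘ₀, rfl⟩
  have hm₁ : Measurable fun z : (X × X) × X => (z.1.2, z.2) := by fun_prop
  obtain ⟨Ξ, hΞ, hΞ₁⟩ := exists_gluing Θ (π₁.map Prod.swap) (by
    rw [Measure.map_map measurable_fst measurable_swap, show Prod.fst ∘ Prod.swap = Prod.snd from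
      rfl, h₁.2, ← h.2, ← hΘ, Measure.map_map measurable_snd hm₁]
    rfl)
  have m₀ : Measurable fun z : ((X × X) × X) × X => z.1.1 := by fun_prop
  have m : Measurable fun z : ((X × X) × X) × X => (z.1.1.2, z.1.2) := by fun_prop
  have m₁ : Measurable fun z : ((X × X) × X) × X => (z.2, z.1.2) := by fun_prop
  have l₀ : Ξ.map (fun z => z.1.1) = π₀ := by
    rw [← hΘ₀, ← hΞ, Measure.map_map measurable_fst measurable_fst]
    rfl
  have l : Ξ.map (fun z => (z.1.1.2, z.1.2)) = π := by
    rw [← hΘ, ← hΞ, Measure.map_map hm₁ measurable_fst]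
    rfl
  have l₁ : Ξ.map (fun z => (z.2, z.1.2)) = π₁ := by
    have : π₁ = (π₁.map Prod.swap).map Prod.swap := by
      rw [Measure.map_map measurable_swap measurable_swap, Prod.swap_swap_eq, Measure.map_id]
    rw [this, ← hΞ₁, Measure.map_map measurable_swap (by fun_prop)]
    rfl
  have hy₀ : Ξ.map (fun z => z.1.1.1) = μ₀.1 := by
    rw [← h₀.1, ← l₀, Measure.map_map measurable_fst m₀]
    rfl
  have hx₀ : Ξ.map (fun z => z.1.1.2) = ν₀.1 := by
    rw [← h₀.2, ← l₀, Measure.map_map measurable_snd m₀]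
    rfl
  have hx₁ : Ξ.map (fun z => z.1.2) = ν₁.1 := by
    rw [← h₁.2, ← l₁, Measure.map_map measurable_snd m₁]
    rfl
  have hy₁ : Ξ.map (fun z => z.2) = μ₁.1 := by
    rw [← h₁.1, ← l₁, Measure.map_map measurable_fst m₁]
    rfl
  have iy₀ := W2Space.integrable_comp (by fun_prop) hy₀ p
  have iy₁ := W2Space.integrable_comp (by fun_prop) hy₁ p
  have hcontr : ∀ g : ((X × X) × X) × X → X, Measurable g →
      Integrable (fun z => dist p (g z) ^ 2) Ξ → Integrable (fun z => dist p (f (g z)) ^ 2) Ξ := by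
    intro g hg hi
    refine hi.mono' ((measurable_const.dist (hf.comp hg)).pow_const 2).aestronglyMeasurable
      (Eventually.of_forall fun z => ?_)
    rw [Real.norm_of_nonneg (sq_nonneg _)]
    exact pow_le_pow_left₀ dist_nonneg (hfp _) 2
  have mx₀ : Measurable fun z : ((X × X) × X) × X => z.1.1.2 := by fun_prop
  have mx₁ : Measurable fun z : ((X × X) × X) × X => z.1.2 := by fun_prop
  have my₀ : Measurable fun z : ((X × X) × X) × X => z.1.1.1 := by fun_prop
  have my₁ : Measurable fun z : ((X × X) × X) × X => z.2 := by fun_prop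
  have ix₀ := hcontr _ mx₀ (W2Space.integrable_comp mx₀ hx₀ p)
  have ix₁ := hcontr _ mx₁ (W2Space.integrable_comp mx₁ hx₁ p)
  have k₀ : Integrable (fun z : ((X × X) × X) × X => dist z.1.1.1 (f z.1.1.2) ^ 2) Ξ :=
    integrable_sq_dist_comp p my₀ (hf.comp mx₀) iy₀ ix₀
  have k₁ : Integrable (fun z : ((X × X) × X) × X => dist z.2 (f z.1.2) ^ 2) Ξ :=
    integrable_sq_dist_comp p my₁ (hf.comp mx₁) iy₁ ix₁
  have k : Integrable (fun z : ((X × X) × X) × X => dist (f z.1.1.2) (f z.1.2) ^ 2) Ξ :=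
    integrable_sq_dist_comp p (hf.comp mx₀) (hf.comp mx₁) ix₀ ix₁
  have ky := integrable_sq_dist_comp p my₀ my₁ iy₀ iy₁
  have hsum : Integrable (fun z : ((X × X) × X) × X =>
      2 * dist z.1.1.1 (f z.1.1.2) ^ 2 + 2 * dist z.2 (f z.1.2) ^ 2) Ξ :=
    (k₀.const_mul 2).add (k₁.const_mul 2)
  have hpt : ∀ z : ((X × X) × X) × X,
      (dist z.1.1.1 (f z.1.1.2) + dist z.2 (f z.1.2)) ^ 2 ≤
        2 * dist z.1.1.1 (f z.1.1.2) ^ 2 + 2 * dist z.2 (f z.1.2) ^ 2 := fun z => by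
    linarith [sq_nonneg (dist z.1.1.1 (f z.1.1.2) - dist z.2 (f z.1.2))]
  have kk : Integrable (fun z : ((X × X) × X) × X =>
      (dist z.1.1.1 (f z.1.1.2) + dist z.2 (f z.1.2)) ^ 2) Ξ := by
    refine hsum.mono' (((my₀.dist (hf.comp mx₀)).add (my₁.dist (hf.comp mx₁))).pow_const
      2).aestronglyMeasurable (Eventually.of_forall fun z => ?_)
    rw [Real.norm_of_nonneg (sq_nonneg _)]
    exact hpt z
  have mf : Measurable fun z : X × X => dist z.1 (f z.2) ^ 2 :=
    (measurable_fst.dist (hf.comp measurable_snd)).pow_const 2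
  have mff : Measurable fun z : X × X => dist (f z.1) (f z.2) ^ 2 :=
    ((hf.comp measurable_fst).dist (hf.comp measurable_snd)).pow_const 2
  have e₀ : ∫ z, dist z.1.1.1 (f z.1.1.2) ^ 2 ∂Ξ = ∫ z, dist z.1 (f z.2) ^ 2 ∂π₀ := by
    rw [← l₀, integral_map m₀.aemeasurable mf.aestronglyMeasurable]
  have e₁ : ∫ z, dist z.2 (f z.1.2) ^ 2 ∂Ξ = ∫ z, dist z.1 (f z.2) ^ 2 ∂π₁ := by
    rw [← l₁, integral_map m₁.aemeasurable mf.aestronglyMeasurable]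
  have e : ∫ z, dist (f z.1.1.2) (f z.1.2) ^ 2 ∂Ξ = ∫ z, dist (f z.1) (f z.2) ^ 2 ∂π := by
    rw [← l, integral_map m.aemeasurable mff.aestronglyMeasurable]
  have hmain := integral_sq_le_of_le_add (Θ := Ξ) (f := fun z => dist z.1.1.1 z.2)
    (g := fun z => dist (f z.1.1.2) (f z.1.2))
    (k := fun z => dist z.1.1.1 (f z.1.1.2) + dist z.2 (f z.1.2)) (fun _ => dist_nonneg)
    (fun z => by
      linarith [dist_triangle4_right z.1.1.1 z.2 (f z.1.1.2) (f z.1.2)])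
    ky k kk hθ
  have hk : ∫ z, (dist z.1.1.1 (f z.1.1.2) + dist z.2 (f z.1.2)) ^ 2 ∂Ξ ≤ 4 * B := by
    refine (integral_mono kk hsum hpt).trans ?_
    rw [integral_add (k₀.const_mul 2) (k₁.const_mul 2), integral_const_mul, integral_const_mul,
      e₀, e₁]
    linarith
  rw [e] at hmain
  have hθ' : 0 ≤ 1 + 1 / θ := by positivity
  exact (Wdist_sq_le_integral p my₀ my₁ hy₀ hy₁).trans
    (hmain.trans (add_le_add_right (mul_le_mul_of_nonneg_left hk hθ') _))

end Contraction

/-- In the Wasserstein space of a visibility Hadamard space, there is no isometric image of a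
normed space containing three unit vectors with the mutual distances `1, 1, √3` of consecutive
vertices of a regular hexagon. -/
lemma IsVisibility.not_isometric_of_hexagon {X : Type*} [MetricSpace X] [MeasurableSpace X]
    [BorelSpace X] (hX : IsHadamard X) (hvis : IsVisibility X) {E : Type*}
    [NormedAddCommGroup E] [NormedSpace ℝ E] {u₀ u₁ u₂ : E} (hu₀ : ‖u₀‖ = 1) (hu₁ : ‖u₁‖ = 1)
    (hu₂ : ‖u₂‖ = 1) (h₀₁ : dist u₀ u₁ = 1) (h₁₂ : dist u₁ u₂ = 1) (h₀₂ : dist u₀ u₂ = √3)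
    (φ : E → W2Space X) : ¬ ∀ u v, Wdist (φ u) (φ v) = dist u v := by
  intro hφ
  have := hX.complete
  have := hX.separable
  have := hX.locallyCompact
  have := UniformSpace.secondCountable_of_separable X
  have := hX.geodesic.properSpace
  have hprob : ∀ v, IsProbabilityMeasure (φ v).1 := fun v => (φ v).2.1
  obtain ⟨p, -⟩ := (φ 0).2.2
  have : Nonempty X := ⟨p⟩
  obtain ⟨h, hh⟩ := hX.geodesic.exists_pencil p
  obtain ⟨K, hK, hmom⟩ := exists_moment_bound hφ p
  set a : ℝ := 5000000 * (4 * K + 1)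
  have ha1 : 1 ≤ a := by linarith
  have ha : 0 < a := by linarith
  set κ : ℝ := 1 / 1000 with hκ
  have hκ0 : 0 < κ := by norm_num [hκ]
  obtain ⟨T₀, hT₀⟩ := hh.exists_spread hX hvis ha hκ0 (by norm_num [hκ])
  set C : ℝ := (8 / κ ^ 2 + 4) * (18 * K) with hC
  have hC0 : 0 < C := by positivity
  set T : ℝ := max (max T₀ a) (10 + 3 * C)
  have hTT₀ : T₀ ≤ T := (le_max_left _ _).trans (le_max_left _ _)
  have haT : a ≤ T := (le_max_right _ _).trans (le_max_left _ _)
  have hTC : 10 + 3 * C ≤ T := le_max_right _ _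
  have hT : 0 < T := ha.trans_le haT
  have hs : a / T ∈ Icc (0 : ℝ) 1 := ⟨div_nonneg ha.le hT.le, (div_le_one hT).2 haT⟩
  set f := h (a / T)
  have hf : Continuous f := hh.continuous hX hs
  have hfp : ∀ x, dist p (f x) ≤ dist p x := fun x => by
    have := (hh x).2.2 0 (by simp) _ hs
    simp only [(hh x).1] at this
    rw [zero_sub, abs_neg, abs_of_nonneg hs.1] at this
    exact this.le.trans (mul_le_of_le_one_right dist_nonneg hs.2)
  have hnorm : ∀ u : E, ‖u‖ = 1 → ∀ t : ℝ, 0 ≤ t → ‖t • u‖ = t := fun u hu t ht => by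
    rw [norm_smul, hu, mul_one, Real.norm_of_nonneg ht]
  have hdist : ∀ (u v : E) (t : ℝ), 0 ≤ t → Wdist (φ (t • u)) (φ (t • v)) = t * dist u v :=
    fun u v t ht => by rw [hφ, dist_smul₀, Real.norm_of_nonneg ht]
  have hmomu : ∀ u : E, ‖u‖ = 1 → ∀ t : ℝ, 0 ≤ t →
      |(φ (t • u)).moment p - t ^ 2| ≤ K * (1 + t) := fun u hu t ht => by
    simpa only [hnorm u hu t ht] using hmom (t • u)
  have hsphere : ∀ u : E, ‖u‖ = 1 →
      Integrable (fun x => (dist p x - T) ^ 2) (φ (T • u)).1 ∧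
        ∫ x, (dist p x - T) ^ 2 ∂(φ (T • u)).1 ≤ 6 * (K * (1 + T)) := fun u hu => by
    refine W2Space.integral_dist_sub_sq_le p (ν := φ (T • (-u))) hT.le (by positivity) ?_ ?_ ?_
    · rw [hdist _ _ _ hT.le, dist_eq_norm, sub_neg_eq_add, ← two_smul ℝ u, norm_smul, hu]
      norm_num
      ring
    · linarith [(abs_le.1 (hmomu u hu T hT.le)).2]
    · linarith [(abs_le.1 (hmomu (-u) (by rwa [norm_neg]) T hT.le)).2]
  have hcontr : ∀ u : E, ‖u‖ = 1 → ∃ π, IsCoupling π (φ (a • u)).1 (φ (T • u)).1 ∧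
      ∫ z, dist z.1 (f z.2) ^ 2 ∂π ≤ 2 * K * (1 + a) + 1 := fun u hu => by
    refine hh.exists_isCoupling_contraction hX ha haT hK ?_ ?_ ?_
    · rw [hφ, dist_comm, dist_eq_norm, ← sub_smul, hnorm u hu _ (by linarith)]
    · linarith [(abs_le.1 (hmomu u hu a ha.le)).2]
    · linarith [(abs_le.1 (hmomu u hu T hT.le)).1]
  have hfar : ∀ u v : E, ‖u‖ = 1 → ‖v‖ = 1 → dist u v = 1 → ∀ π : Measure (X × X),
      IsCoupling π (φ (T • u)).1 (φ (T • v)).1 →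
      0.997 * T ^ 2 ≤ ∫ z, (dist (f z.1) (f z.2) * (T / a)) ^ 2 ∂π := by
    intro u v hu hv huv π hπ
    obtain ⟨π₀, hπ₀, hB₀⟩ := hcontr u hu
    obtain ⟨π₁, hπ₁, hB₁⟩ := hcontr v hv
    have := Wdist_sq_le_contraction hf.measurable hfp hπ₀ hπ₁ hπ hκ0 hB₀ hB₁
    rw [hdist _ _ _ ha.le, huv, mul_one] at this
    simp only [mul_pow]
    rw [integral_mul_const]
    set I := ∫ z, dist (f z.1) (f z.2) ^ 2 ∂π
    have hB : 2 * K * (1 + a) + 1 ≤ (4 * K + 1) * a := by nlinarith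
    have hI : 0.997 * a ^ 2 ≤ I := by
      have e : 5000000 * ((4 * K + 1) * a) = a ^ 2 := by
        rw [pow_two, ← mul_assoc]
      rw [hκ] at this
      norm_num at this
      nlinarith
    calc 0.997 * T ^ 2 = 0.997 * a ^ 2 * (T / a) ^ 2 := by field_simp
      _ ≤ I * (T / a) ^ 2 := by gcongr
  obtain ⟨π₀₁, hπ₀₁, hc₀₁⟩ := exists_isCoupling_le (φ (T • u₀)) (φ (T • u₁)) p one_pos
  obtain ⟨π₁₂, hπ₁₂, hc₁₂⟩ := exists_isCoupling_le (φ (T • u₁)) (φ (T • u₂)) p one_pos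
  rw [hdist _ _ _ hT.le, h₀₁, mul_one] at hc₀₁
  rw [hdist _ _ _ hT.le, h₁₂, mul_one] at hc₁₂
  have hg₀₁ := hfar u₀ u₁ hu₀ hu₁ h₀₁ π₀₁ hπ₀₁
  have hg₁₂ := hfar u₁ u₂ hu₁ hu₂ h₁₂ π₁₂ hπ₁₂
  have := hπ₀₁.isProbabilityMeasure
  have := hπ₁₂.isProbabilityMeasure
  obtain ⟨Θ, hΘ, hΘ'⟩ := exists_gluing π₀₁ π₁₂ (hπ₀₁.2.trans hπ₁₂.1.symm)
  have : IsProbabilityMeasure Θ := IsCoupling.isProbabilityMeasure (μ := π₀₁) ⟨hΘ, rfl⟩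
  have m₀ : Measurable fun z : (X × X) × X => z.1.1 := by fun_prop
  have m₁ : Measurable fun z : (X × X) × X => z.1.2 := by fun_prop
  have m₂ : Measurable fun z : (X × X) × X => z.2 := by fun_prop
  have m₁₂ : Measurable fun z : (X × X) × X => (z.1.2, z.2) := by fun_prop
  have x₀ : Θ.map (fun z => z.1.1) = (φ (T • u₀)).1 := by
    rw [← hπ₀₁.1, ← hΘ, Measure.map_map measurable_fst measurable_fst]
    rfl
  have x₁ : Θ.map (fun z => z.1.2) = (φ (T • u₁)).1 := by
    rw [← hπ₀₁.2, ← hΘ, Measure.map_map measurable_snd measurable_fst]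
    rfl
  have x₂ : Θ.map (fun z => z.2) = (φ (T • u₂)).1 := by
    rw [← hπ₁₂.2, ← hΘ', Measure.map_map measurable_snd m₁₂]
    rfl
  have i₀ := W2Space.integrable_comp m₀ x₀ p
  have i₁ := W2Space.integrable_comp m₁ x₁ p
  have i₂ := W2Space.integrable_comp m₂ x₂ p
  have d₀₁ := integrable_sq_dist_comp p m₀ m₁ i₀ i₁
  have d₁₂ := integrable_sq_dist_comp p m₁ m₂ i₁ i₂
  have d₀₂ := integrable_sq_dist_comp p m₀ m₂ i₀ i₂
  have hgle : ∀ x y, dist (f x) (f y) * (T / a) ≤ dist x y := fun x y =>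
    calc dist (f x) (f y) * (T / a) ≤ a / T * dist x y * (T / a) :=
          mul_le_mul_of_nonneg_right (hh.dist_le_mul hX hs x y) (by positivity)
      _ = dist x y := by field_simp
  have hgint : ∀ b c : (X × X) × X → X, Measurable b → Measurable c →
      Integrable (fun z => dist (b z) (c z) ^ 2) Θ →
      Integrable (fun z => (dist (f (b z)) (f (c z)) * (T / a)) ^ 2) Θ := by
    intro b c hb hc hi
    refine hi.mono' ((((hf.measurable.comp hb).dist (hf.measurable.comp hc)).mul_const
      _).pow_const 2).aestronglyMeasurable (Eventually.of_forall fun z => ?_)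
    rw [Real.norm_of_nonneg (sq_nonneg _)]
    exact pow_le_pow_left₀ (by positivity) (hgle _ _) 2
  have g₀₁ := hgint _ _ m₀ m₁ d₀₁
  have g₁₂ := hgint _ _ m₁ m₂ d₁₂
  have hsph : ∀ (b : (X × X) × X → X) (u : E), Measurable b → ‖u‖ = 1 →
      Θ.map b = (φ (T • u)).1 → Integrable (fun z => (dist p (b z) - T) ^ 2) Θ ∧
        ∫ z, (dist p (b z) - T) ^ 2 ∂Θ ≤ 6 * (K * (1 + T)) := by
    intro b u hb hu hbu
    obtain ⟨h1, h2⟩ := hsphere u hu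
    rw [← hbu] at h1 h2
    refine ⟨h1.comp_measurable hb, ?_⟩
    rwa [integral_map hb.aemeasurable (by fun_prop)] at h2
  obtain ⟨s₀, s₀'⟩ := hsph _ u₀ m₀ hu₀ x₀
  obtain ⟨s₁, s₁'⟩ := hsph _ u₁ m₁ hu₁ x₁
  obtain ⟨s₂, s₂'⟩ := hsph _ u₂ m₂ hu₂ x₂
  have hspread : ∀ x y, |dist p x - T| ≤ κ * T → |dist p y - T| ≤ κ * T →
      3 * κ * T ≤ dist (f x) (f y) * (T / a) → (2 - 7 * κ) * T ≤ dist x y := by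
    intro x y hx hy hxy
    refine hT₀ T hTT₀ x y hx hy ?_
    rw [← mul_div_assoc (dist (f x) (f y)), le_div_iff₀ ha] at hxy
    exact le_of_mul_le_mul_right ((mul_right_comm (3 * κ) a T).trans_le hxy) hT
  have hpt : ∀ z : (X × X) × X, dist z.1.1 z.2 ^ 2 ≤
      dist z.1.1 z.1.2 ^ 2 + dist z.1.2 z.2 ^ 2 + 76 * κ * T ^ 2 +
      2 * (dist z.1.1 z.1.2 ^ 2 - (dist (f z.1.1) (f z.1.2) * (T / a)) ^ 2) +
      2 * (dist z.1.2 z.2 ^ 2 - (dist (f z.1.2) (f z.2) * (T / a)) ^ 2) +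
      (8 / κ ^ 2 + 4) *
        ((dist p z.1.1 - T) ^ 2 + (dist p z.1.2 - T) ^ 2 + (dist p z.2 - T) ^ 2) := fun z =>
    sq_le_of_spread hκ0 (by norm_num [hκ]) hT dist_nonneg
      (by positivity) (by positivity) (dist_triangle _ _ _) (dist_triangle_left _ _ _)
      (hgle _ _) (hgle _ _) (hspread _ _) (hspread _ _)
  have t₁ := d₀₁.add d₁₂
  have t₂ := t₁.add (integrable_const (76 * κ * T ^ 2))
  have v₀₁ := (d₀₁.sub g₀₁).const_mul 2
  have v₁₂ := (d₁₂.sub g₁₂).const_mul 2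
  have t₃ := t₂.add v₀₁
  have t₄ := t₃.add v₁₂
  have w₁ := s₀.add s₁
  have w₂ := w₁.add s₂
  have w₃ := w₂.const_mul (8 / κ ^ 2 + 4)
  have hdi := integral_mono d₀₂ (t₄.add w₃) hpt
  rw [integral_add' t₄ w₃, integral_add' t₃ v₁₂, integral_add' t₂ v₀₁,
    integral_add' t₁ (integrable_const _), integral_add' d₀₁ d₁₂, integral_const_mul,
    integral_const_mul, integral_const_mul, integral_const_mul, integral_sub' d₀₁ g₀₁, integral_sub' d₁₂ g₁₂,
    integral_add' w₁ s₂, integral_add' s₀ s₁, integral_const] at hdi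
  have q₀₁ : ∫ z, dist z.1.1 z.1.2 ^ 2 ∂Θ ≤ T ^ 2 + 1 := by
    rwa [← hΘ, integral_map measurable_fst.aemeasurable (by fun_prop)] at hc₀₁
  have q₁₂ : ∫ z, dist z.1.2 z.2 ^ 2 ∂Θ ≤ T ^ 2 + 1 := by
    rwa [← hΘ', integral_map m₁₂.aemeasurable (by fun_prop)] at hc₁₂
  rw [← hΘ, integral_map measurable_fst.aemeasurable (by fun_prop)] at hg₀₁
  rw [← hΘ', integral_map m₁₂.aemeasurable (by fun_prop)] at hg₁₂
  have hlow : 3 * T ^ 2 ≤ ∫ z, dist z.1.1 z.2 ^ 2 ∂Θ := by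
    refine le_trans (le_of_eq ?_) (Wdist_sq_le_integral p m₀ m₂ x₀ x₂)
    rw [hdist _ _ _ hT.le, h₀₂, mul_pow, Real.sq_sqrt (by norm_num)]
    ring
  have hCs := mul_le_mul_of_nonneg_left (add_le_add (add_le_add s₀' s₁') s₂')
    (show 0 ≤ 8 / κ ^ 2 + 4 by positivity)
  have hC' : (8 / κ ^ 2 + 4) * (6 * (K * (1 + T)) + 6 * (K * (1 + T)) + 6 * (K * (1 + T))) =
      C * (1 + T) := by
    rw [hC]
    ring
  rw [hC'] at hCs
  have hκT : 76 * κ * T ^ 2 = 0.076 * T ^ 2 := by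
    rw [hκ]
    ring
  simp only [probReal_univ, one_smul] at hdi
  nlinarith

/-- If `X` is a Hadamard space which is a visibility space, then there is
no isometric embedding of the Euclidean plane into the quadratic Wasserstein space
`W₂(X)`: the latter has rank 1. -/
theorem wasserstein_rank_one (X : Type*) [MetricSpace X] [MeasurableSpace X] [BorelSpace X]
    (hX : IsHadamard X) (hvis : IsVisibility X) :
    ¬ ∃ φ : EuclideanSpace ℝ (Fin 2) → W2Space X,
        ∀ u v : EuclideanSpace ℝ (Fin 2), Wdist (φ u) (φ v) = dist u v := by
  rintro ⟨φ, hφ⟩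
  have h3 : √3 ^ 2 = (3 : ℝ) := Real.sq_sqrt (by norm_num)
  refine hvis.not_isometric_of_hexagon hX (u₀ := !₂[1, 0]) (u₁ := !₂[1 / 2, √3 / 2])
    (u₂ := !₂[-(1 / 2), √3 / 2]) ?_ ?_ ?_ ?_ ?_ ?_ φ hφ
  · simp [EuclideanSpace.norm_eq]
  · rw [EuclideanSpace.norm_eq, Real.sqrt_eq_one]
    simp only [Fin.sum_univ_two, Real.norm_eq_abs, sq_abs]
    simp
    linarith
  · rw [EuclideanSpace.norm_eq, Real.sqrt_eq_one]
    simp only [Fin.sum_univ_two, Real.norm_eq_abs, sq_abs]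
    simp
    linarith
  · rw [EuclideanSpace.dist_eq, Real.sqrt_eq_one]
    simp only [Fin.sum_univ_two, Real.dist_eq, sq_abs]
    simp
    linarith
  · rw [EuclideanSpace.dist_eq, Real.sqrt_eq_one]
    simp only [Fin.sum_univ_two, Real.dist_eq, sq_abs]
    simp
    norm_num
  · rw [EuclideanSpace.dist_eq]
    congr 1
    simp only [Fin.sum_univ_two, Real.dist_eq, sq_abs]
    simp
    linarith

end
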